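/- arXiv:2307.11855 — 7 statements merged into one kernel-verified Lean document; each statement's English description precedes it below -/
import Mathlib

section
/- Additive drift theorem, upper bound: Let S ⊆ ℝ be a finite set of positive numbers and let (X^t)_{t∈ℕ} be a sequence of random variables taking values in S ∪ {0}. Let T be the first point in time t ∈ ℕ for which X^t ≤ 0. If there exists a constant δ₁ > 0 such that for all t, E[X^t − X^{t+1} | T > t] ≥ δ₁, then E[T | X^0] ≤ X^0 / δ₁. -/
open MeasureTheory
open scoped ENNReal

theorem enat_eq_tsum_aux (n : ℕ∞) :
    (n : ℝ≥0∞) = ∑' t : ℕ, (if (t : ℕ∞) < n then (1 : ℝ≥0∞) else 0) := by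
  induction n using ENat.recTopCoe with
  | top => simp [ENNReal.tsum_const_eq_top_of_ne_zero]
  | coe n =>
    rw [tsum_eq_sum (s := Finset.range n)]
    · rw [Finset.sum_congr rfl (g := fun _ => (1 : ℝ≥0∞))]
      · simp
      · intro t ht
        have := Finset.mem_range.1 ht
        simp [this]
    · intro t ht
      have : ¬ t < n := fun h => ht (Finset.mem_range.2 h)
      simpa using this

/-- **Additive Drift Theorem, upper bound.**
Let `S ⊆ ℝ` be a finite set of positive numbers and let `(X t)` be a sequence of random
variables over `S ∪ {0}` on a probability space, starting deterministically at `x0`.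
Let `T` be the first point in time `t` for which `X t ≤ 0` (with value `⊤` if no such time
exists).  If there is a constant `δ₁ > 0` such that for every `t`,
`E[X t − X (t+1) ∣ T > t] ≥ δ₁` (formulated, as usual, in the multiplied-out form
`δ₁ · P(T > t) ≤ ∫_{T > t} (X t − X (t+1))`), then `E[T] ≤ x0 / δ₁`. -/
theorem additive_drift_upper_bound
    {Ω : Type*} [MeasurableSpace Ω] (μ : Measure Ω) [IsProbabilityMeasure μ]
    (X : ℕ → Ω → ℝ) (hXmeas : ∀ t, Measurable (X t))
    (S : Finset ℝ) (hSpos : ∀ s ∈ S, (0 : ℝ) < s)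
    (hrange : ∀ t ω, X t ω ∈ (S : Set ℝ) ∪ {0})
    (T : Ω → ℕ∞)
    (hT : ∀ ω, T ω = sInf {t : ℕ∞ | ∃ s : ℕ, t = (s : ℕ∞) ∧ X s ω ≤ 0})
    (x0 : ℝ) (hX0 : ∀ ω, X 0 ω = x0)
    (δ₁ : ℝ) (hδ₁ : 0 < δ₁)
    (hdrift : ∀ t : ℕ,
      δ₁ * (μ {ω | (t : ℕ∞) < T ω}).toReal
        ≤ ∫ ω in {ω | (t : ℕ∞) < T ω}, (X t ω - X (t + 1) ω) ∂μ) :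
    ∫⁻ ω, (T ω : ℝ≥0∞) ∂μ ≤ ENNReal.ofReal (x0 / δ₁) := by
  have hlt : ∀ (t : ℕ) ω, (t : ℕ∞) < T ω ↔ ∀ s ≤ t, 0 < X s ω := by
    intro t ω
    constructor
    · intro h s hs
      by_contra hc
      have h1 : T ω ≤ (s : ℕ∞) := by
        rw [hT]; exact sInf_le ⟨s, rfl, not_lt.1 hc⟩
      have h2 : (s : ℕ∞) ≤ t := by exact_mod_cast hs
      exact absurd (h1.trans h2) (not_le.2 h)
    · intro h
      have h1 : ((t + 1 : ℕ) : ℕ∞) ≤ T ω := by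
        rw [hT]
        refine le_sInf ?_
        rintro _ ⟨s, rfl, hs⟩
        have : t < s := by
          by_contra hc
          exact absurd (h s (not_lt.1 hc)) (not_lt.2 hs)
        exact_mod_cast this
      refine lt_of_lt_of_le ?_ h1
      exact_mod_cast Nat.lt_succ_self t
  have hnn : ∀ t ω, 0 ≤ X t ω := by
    intro t ω
    rcases hrange t ω with h | h
    · exact (hSpos _ h).le
    · exact (show X t ω = 0 from h).ge
  have hbd : ∀ t ω, X t ω ≤ ∑ s ∈ S, s := by
    intro t ω
    rcases hrange t ω with h | h
    · exact Finset.single_le_sum (f := fun s : ℝ => s) (fun i hi => (hSpos i hi).le) h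
    · rw [show X t ω = 0 from h]
      exact Finset.sum_nonneg (fun i hi => (hSpos i hi).le)
  have hint : ∀ t, Integrable (X t) μ := by
    intro t
    refine Integrable.of_bound (hXmeas t).aestronglyMeasurable (∑ s ∈ S, s) ?_
    refine Filter.Eventually.of_forall fun ω => ?_
    rw [Real.norm_of_nonneg (hnn t ω)]
    exact hbd t ω
  have hA : ∀ t : ℕ, MeasurableSet {ω | (t : ℕ∞) < T ω} := by
    intro t
    have : {ω | (t : ℕ∞) < T ω} = ⋂ s : ℕ, ⋂ _ : s ≤ t, {ω | 0 < X s ω} := by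
      ext ω
      simp only [Set.mem_setOf_eq, Set.mem_iInter]
      exact hlt t ω
    rw [this]
    exact MeasurableSet.iInter fun s => MeasurableSet.iInter fun _ =>
      measurableSet_lt measurable_const (hXmeas s)
  have hstep : ∀ t : ℕ, δ₁ * (μ {ω | (t : ℕ∞) < T ω}).toReal
      ≤ (∫ ω in {ω | (t : ℕ∞) < T ω}, X t ω ∂μ)
        - ∫ ω in {ω | ((t + 1 : ℕ) : ℕ∞) < T ω}, X (t + 1) ω ∂μ := by
    intro t
    have h1 := hdrift t
    rw [integral_sub (hint t).integrableOn (hint (t + 1)).integrableOn] at h1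
    have h2 : ∫ ω in {ω | ((t + 1 : ℕ) : ℕ∞) < T ω}, X (t + 1) ω ∂μ
        ≤ ∫ ω in {ω | (t : ℕ∞) < T ω}, X (t + 1) ω ∂μ := by
      refine setIntegral_mono_set (hint (t + 1)).integrableOn
        (Filter.Eventually.of_forall fun ω => hnn (t + 1) ω)
        (Filter.Eventually.of_forall ?_)
      intro ω hω
      exact (hlt t ω).2 fun s hs => (hlt (t + 1) ω).1 hω s (hs.trans (Nat.le_succ t))
    linarith
  have hsum : ∀ n : ℕ, δ₁ * ∑ t ∈ Finset.range n, (μ {ω | (t : ℕ∞) < T ω}).toReal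
      ≤ (∫ ω in {ω | ((0 : ℕ) : ℕ∞) < T ω}, X 0 ω ∂μ)
        - ∫ ω in {ω | (n : ℕ∞) < T ω}, X n ω ∂μ := by
    intro n
    induction n with
    | zero => simp
    | succ n ih =>
      rw [Finset.sum_range_succ, mul_add]
      linarith [hstep n]
  have h0 : ∫ ω in {ω | ((0 : ℕ) : ℕ∞) < T ω}, X 0 ω ∂μ ≤ x0 := by
    refine (setIntegral_le_integral (hint 0)
      (Filter.Eventually.of_forall fun ω => hnn 0 ω)).trans ?_
    simp [hX0]
  have hfin : ∀ n : ℕ, ∑ t ∈ Finset.range n, (μ {ω | (t : ℕ∞) < T ω}).toReal ≤ x0 / δ₁ := by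
    intro n
    rw [le_div_iff₀ hδ₁]
    have h3 : 0 ≤ ∫ ω in {ω | (n : ℕ∞) < T ω}, X n ω ∂μ :=
      integral_nonneg fun ω => hnn n ω
    linarith [hsum n]
  have hlint : ∫⁻ ω, (T ω : ℝ≥0∞) ∂μ = ∑' t : ℕ, μ {ω | (t : ℕ∞) < T ω} := by
    calc ∫⁻ ω, (T ω : ℝ≥0∞) ∂μ
        = ∫⁻ ω, ∑' t : ℕ, ({ω | (t : ℕ∞) < T ω}.indicator 1 ω : ℝ≥0∞) ∂μ := by
          refine lintegral_congr fun ω => ?_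
          rw [enat_eq_tsum_aux]
          refine tsum_congr fun t => ?_
          simp [Set.indicator_apply]
      _ = ∑' t : ℕ, ∫⁻ ω, ({ω | (t : ℕ∞) < T ω}.indicator 1 ω : ℝ≥0∞) ∂μ :=
          lintegral_tsum fun t => (measurable_one.indicator (hA t)).aemeasurable
      _ = _ := tsum_congr fun t => lintegral_indicator_one (hA t)
  rw [hlint]
  refine ENNReal.tsum_le_of_sum_range_le fun n => ?_
  rw [← ENNReal.ofReal_toReal (a := ∑ t ∈ Finset.range n, μ {ω | (t : ℕ∞) < T ω})
    (ENNReal.sum_ne_top.2 fun t _ => measure_ne_top μ _)]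
  refine ENNReal.ofReal_le_ofReal ?_
  rw [ENNReal.toReal_sum fun t _ => measure_ne_top μ _]
  exact hfin n
end

section
/- Additive drift theorem, lower bound: Let S ⊆ ℝ be a finite set of positive numbers and let (X^t)_{t∈ℕ} be a sequence of random variables taking values in S ∪ {0}. Let T be the first point in time t ∈ ℕ for which X^t ≤ 0. If there exists a constant δ₂ > 0 such that for all t, E[X^t − X^{t+1} | T > t] ≤ δ₂, then E[T | X^0] ≥ X^0 / δ₂. -/
open MeasureTheory
open scoped ENNReal

/-- **Additive Drift Theorem, lower bound.**
Let `S ⊆ ℝ` be a finite set of positive numbers and let `(X t)` be a sequence of random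
variables over `S ∪ {0}` on a probability space, starting deterministically at `x0`.
Let `T` be the first point in time `t` for which `X t ≤ 0` (with value `⊤` if no such time
exists).  If there is a constant `δ₂ > 0` such that for every `t`,
`E[X t − X (t+1) ∣ T > t] ≤ δ₂` (formulated, as usual, in the multiplied-out form
`∫_{T > t} (X t − X (t+1)) ≤ δ₂ · P(T > t)`), then `E[T] ≥ x0 / δ₂`. -/
theorem additive_drift_lower_bound
    {Ω : Type*} [MeasurableSpace Ω] (μ : Measure Ω) [IsProbabilityMeasure μ]
    (X : ℕ → Ω → ℝ) (hXmeas : ∀ t, Measurable (X t))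
    (S : Finset ℝ) (hSpos : ∀ s ∈ S, (0 : ℝ) < s)
    (hrange : ∀ t ω, X t ω ∈ (S : Set ℝ) ∪ {0})
    (T : Ω → ℕ∞)
    (hT : ∀ ω, T ω = sInf {t : ℕ∞ | ∃ s : ℕ, t = (s : ℕ∞) ∧ X s ω ≤ 0})
    (x0 : ℝ) (hX0 : ∀ ω, X 0 ω = x0)
    (δ₂ : ℝ) (hδ₂ : 0 < δ₂)
    (hdrift : ∀ t : ℕ,
      ∫ ω in {ω | (t : ℕ∞) < T ω}, (X t ω - X (t + 1) ω) ∂μ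
        ≤ δ₂ * (μ {ω | (t : ℕ∞) < T ω}).toReal) :
    ENNReal.ofReal (x0 / δ₂) ≤ ∫⁻ ω, (T ω : ℝ≥0∞) ∂μ := by
  classical
  set A : ℕ → Set Ω := fun t => {ω | (t : ℕ∞) < T ω} with hA
  have hAmem : ∀ t ω, ω ∈ A t ↔ ∀ s ≤ t, 0 < X s ω := by
    intro t ω
    simp only [hA, Set.mem_setOf_eq, hT]
    constructor
    · intro h s hs
      by_contra hc
      have h1 : sInf {t : ℕ∞ | ∃ s : ℕ, t = (s : ℕ∞) ∧ X s ω ≤ 0} ≤ (s : ℕ∞) :=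
        sInf_le ⟨s, rfl, not_lt.mp hc⟩
      have h2 := lt_of_lt_of_le h h1
      have h3 : t < s := by exact_mod_cast h2
      omega
    · intro h
      have h1 : ((t + 1 : ℕ) : ℕ∞) ≤ sInf {t : ℕ∞ | ∃ s : ℕ, t = (s : ℕ∞) ∧ X s ω ≤ 0} := by
        apply le_sInf
        rintro _ ⟨s, rfl, hs⟩
        by_contra hc
        have h3 : s < t + 1 := by exact_mod_cast not_le.mp hc
        exact absurd (h s (by omega)) (not_lt.mpr hs)
      refine lt_of_lt_of_le ?_ h1
      exact_mod_cast Nat.lt_succ_self t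
  have hAmeas : ∀ t, MeasurableSet (A t) := by
    intro t
    have : A t = ⋂ s, ⋂ (_ : s ≤ t), {ω | 0 < X s ω} := by
      ext ω
      simp [hAmem]
    rw [this]
    exact MeasurableSet.iInter fun s => MeasurableSet.iInter fun _ =>
      measurableSet_lt measurable_const (hXmeas s)
  have hnn : ∀ t ω, 0 ≤ X t ω := by
    intro t ω
    rcases hrange t ω with h | h
    · exact (hSpos _ h).le
    · exact le_of_eq h.symm
  have hbd : ∀ t ω, X t ω ≤ ∑ s ∈ S, s := by
    intro t ω
    rcases hrange t ω with h | h
    · exact Finset.single_le_sum (f := fun s : ℝ => s) (fun s hs => (hSpos s hs).le) h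
    · rw [show X t ω = 0 from h]
      exact Finset.sum_nonneg fun s hs => (hSpos s hs).le
  set M : ℝ := ∑ s ∈ S, s with hM
  have hint : ∀ t, Integrable (X t) μ := by
    intro t
    refine Integrable.of_bound (hXmeas t).aestronglyMeasurable M (ae_of_all _ fun ω => ?_)
    rw [Real.norm_eq_abs, abs_of_nonneg (hnn t ω)]
    exact hbd t ω
  have hstep : ∀ t, ∫ ω in A t, X (t + 1) ω ∂μ = ∫ ω in A (t + 1), X (t + 1) ω ∂μ := by
    intro t
    rw [← integral_indicator (hAmeas t), ← integral_indicator (hAmeas (t + 1))]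
    congr 1
    ext ω
    by_cases h1 : ω ∈ A (t + 1)
    · have h2 : ω ∈ A t := (hAmem t ω).2 fun s hs => (hAmem _ ω).1 h1 s (by omega)
      simp [h1, h2]
    · by_cases h2 : ω ∈ A t
      · have h3 : X (t + 1) ω = 0 := by
          by_contra hne
          apply h1
          refine (hAmem _ ω).2 fun s hs => ?_
          rcases Nat.lt_or_ge t s with h | h
          · obtain rfl : s = t + 1 := by omega
            exact lt_of_le_of_ne (hnn _ ω) (Ne.symm hne)
          · exact (hAmem _ ω).1 h2 s h
        simp [h1, h2, h3]
      · simp [h1, h2]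
  have hzero : ∫ ω in A 0, X 0 ω ∂μ = x0 := by
    have : ∫ ω in A 0, X 0 ω ∂μ = ∫ ω, X 0 ω ∂μ := by
      rw [← integral_indicator (hAmeas 0)]
      congr 1
      ext ω
      by_cases h : ω ∈ A 0
      · simp [h]
      · have h3 : X 0 ω = 0 := by
          by_contra hne
          apply h
          refine (hAmem _ ω).2 fun s hs => ?_
          obtain rfl : s = 0 := by omega
          exact lt_of_le_of_ne (hnn _ ω) (Ne.symm hne)
        simp [h3]
    rw [this]
    simp [hX0]
  have hsum : ∀ n : ℕ, x0 - ∫ ω in A n, X n ω ∂μ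
      ≤ δ₂ * ∑ t ∈ Finset.range n, (μ (A t)).toReal := by
    intro n
    induction n with
    | zero => simp [hzero]
    | succ n ih =>
      have h := hdrift n
      rw [integral_sub (hint n).integrableOn (hint (n + 1)).integrableOn] at h
      have h' := hstep n
      rw [Finset.sum_range_succ, mul_add]
      change ∫ ω in A n, X n ω ∂μ - ∫ ω in A n, X (n + 1) ω ∂μ ≤ δ₂ * (μ (A n)).toReal at h
      linarith
  have hlast : ∀ n : ℕ, ∫ ω in A n, X n ω ∂μ ≤ M * (μ (A n)).toReal := by
    intro n
    calc ∫ ω in A n, X n ω ∂μ ≤ ∫ ω in A n, M ∂μ :=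
          integral_mono (hint n).integrableOn (integrable_const _) (fun ω => hbd n ω)
      _ = M * (μ (A n)).toReal := by
          simp [Measure.real, mul_comm]
  have hET : ∀ n : ℕ, ∑ t ∈ Finset.range n, μ (A t) ≤ ∫⁻ ω, (T ω : ℝ≥0∞) ∂μ := by
    intro n
    calc ∑ t ∈ Finset.range n, μ (A t)
        = ∫⁻ ω, ∑ t ∈ Finset.range n, (A t).indicator (fun _ => (1 : ℝ≥0∞)) ω ∂μ := by
          rw [lintegral_finsetSum _ fun t _ => measurable_const.indicator (hAmeas t)]
          refine Finset.sum_congr rfl fun t _ => ?_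
          rw [lintegral_indicator (hAmeas t)]
          simp
      _ ≤ ∫⁻ ω, (T ω : ℝ≥0∞) ∂μ := by
          refine lintegral_mono fun ω => ?_
          rcases hk : T ω with _ | k
          · exact le_top
          · change _ ≤ (((k : ℕ) : ℕ∞) : ℝ≥0∞)
            have hk' : T ω = (k : ℕ∞) := hk
            simp only [Set.indicator_apply, hA, Set.mem_setOf_eq, hk', Nat.cast_lt]
            rw [Finset.sum_boole, ENat.toENNReal_coe]
            have : ((Finset.range n).filter (fun t => t < k)).card ≤ k := by
              calc _ ≤ (Finset.range k).card := Finset.card_le_card (by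
                    intro t ht
                    simp at ht ⊢
                    exact ht.2)
                _ = k := Finset.card_range k
            exact_mod_cast this
  by_cases htop : ∫⁻ ω, (T ω : ℝ≥0∞) ∂μ = ⊤
  · rw [htop]
    exact le_top
  set E := ∫⁻ ω, (T ω : ℝ≥0∞) ∂μ with hE
  have htsum : ∑' t, μ (A t) ≠ ⊤ := by
    refine ne_top_of_le_ne_top htop ?_
    exact ENNReal.tsum_le_of_sum_range_le hET
  have hlim0 : Filter.Tendsto (fun n => μ (A n)) Filter.atTop (nhds 0) :=
    ENNReal.tendsto_atTop_zero_of_tsum_ne_top htsum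
  have hlim : Filter.Tendsto (fun n => δ₂ * E.toReal + M * (μ (A n)).toReal) Filter.atTop
      (nhds (δ₂ * E.toReal + M * 0)) := by
    refine Filter.Tendsto.const_add _ (Filter.Tendsto.const_mul _ ?_)
    have := (ENNReal.tendsto_toReal ENNReal.zero_ne_top).comp hlim0
    simpa [Function.comp_def] using this
  have hmain : x0 ≤ δ₂ * E.toReal + M * 0 := by
    refine ge_of_tendsto' hlim fun n => ?_
    have h1 := hsum n
    have h2 := hlast n
    have h3 : ∑ t ∈ Finset.range n, (μ (A t)).toReal ≤ E.toReal := by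
      rw [← ENNReal.toReal_sum fun t _ => measure_ne_top μ _]
      exact ENNReal.toReal_mono htop (hET n)
    have h4 := mul_le_mul_of_nonneg_left h3 hδ₂.le
    linarith
  refine ENNReal.ofReal_le_of_le_toReal ?_
  rw [div_le_iff₀ hδ₂]
  linarith
end

section
/- Upper bound for the (1+1) EA with the ±1 operator: For every a ∈ ℤⁿ \ {0ⁿ}, the expected optimization time of the (1+1) EA with the ±1 step operator, started at the all-0 integer string, on the fitness function f_a is O(n · (|a|_∞ + log |a|_H)). -/
open scoped ENNReal BigOperators

/-- The fitness `f_a(x) = ∑ i, |x i − a i|` (to be minimized). -/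
def fitness {n : ℕ} (a x : Fin n → ℤ) : ℕ := ∑ i, (x i - a i).natAbs

/-- `|a|₁ = ∑ i, |a i|`. -/
def normOne {n : ℕ} (a : Fin n → ℤ) : ℕ := ∑ i, (a i).natAbs

/-- `|a|_∞ = max_i |a i|`. -/
def normInf {n : ℕ} (a : Fin n → ℤ) : ℕ := Finset.univ.sup fun i => (a i).natAbs

/-- `|a|_H = |{i : a i ≠ 0}|`. -/
def normH {n : ℕ} (a : Fin n → ℤ) : ℕ := (Finset.univ.filter fun i => a i ≠ 0).card

/-- Probability that mutating the single component value `xi` (which happens with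
probability `1/n`, and otherwise the component is left unchanged) results in the value `z`;
here `stepP xi z` is the probability that the step operator applied to `xi` returns `z`. -/
noncomputable def coordMutP (n : ℕ) (stepP : ℤ → ℤ → ℝ≥0∞) (xi z : ℤ) : ℝ≥0∞ :=
  (1 - 1 / (n : ℝ≥0∞)) * (if z = xi then 1 else 0) + (1 / (n : ℝ≥0∞)) * stepP xi z

/-- Probability that the mutation of `x` (each component independently being replaced, with
probability `1/n`, by the result of the step operator) produces the offspring `y`. -/
noncomputable def mutP (n : ℕ) (stepP : ℤ → ℤ → ℝ≥0∞) (x y : Fin n → ℤ) : ℝ≥0∞ :=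
  ∏ i, coordMutP n stepP (x i) (y i)

/-- One-step transition probability of the (1+1) EA on `f_a` with the given step operator:
the offspring `y` is produced by mutation and accepted iff `f_a(y) ≤ f_a(x)`; otherwise
the parent `x` is kept. -/
noncomputable def transP (n : ℕ) (a : Fin n → ℤ) (stepP : ℤ → ℤ → ℝ≥0∞)
    (x y : Fin n → ℤ) : ℝ≥0∞ :=
  (if fitness a y ≤ fitness a x then mutP n stepP x y else 0) +
    (if y = x then ∑' z : Fin n → ℤ,
      (if fitness a x < fitness a z then mutP n stepP x z else 0) else 0)

/-- Distribution of the search point of the (1+1) EA after `t` iterations, started at the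
all-`0` integer string. -/
noncomputable def eaDist (n : ℕ) (a : Fin n → ℤ) (stepP : ℤ → ℤ → ℝ≥0∞) :
    ℕ → (Fin n → ℤ) → ℝ≥0∞
  | 0 => fun x => if x = (fun _ => 0) then 1 else 0
  | t + 1 => fun y => ∑' x : Fin n → ℤ, eaDist n a stepP t x * transP n a stepP x y

/-- Expected optimization time of the (1+1) EA on `f_a` (started at the all-`0` string):
since the optimum is absorbing, `E[T] = ∑_{t ≥ 0} P(T > t) = ∑_{t ≥ 0} P(f_a(X_t) ≠ 0)`. -/
noncomputable def eaExpTime (n : ℕ) (a : Fin n → ℤ) (stepP : ℤ → ℤ → ℝ≥0∞) : ℝ≥0∞ :=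
  ∑' t : ℕ, ∑' x : Fin n → ℤ, if fitness a x = 0 then 0 else eaDist n a stepP t x

/-- The `±1` step operator: with probability `1/2` return `xi + 1`, otherwise `xi - 1`. -/
noncomputable def pmStepP (xi z : ℤ) : ℝ≥0∞ :=
  (if z = xi + 1 then 1 / 2 else 0) + (if z = xi - 1 then 1 / 2 else 0)

/-- `c_ε = ∑_{i ≥ 2} 1 / (i (log i)^{1+ε})`. -/
noncomputable def cEps (ε : ℝ) : ℝ :=
  ∑' i : ℕ, if 2 ≤ i then 1 / (i * Real.log i ^ (1 + ε)) else 0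

/-- The heavy-tailed step operator with parameter `ε`: sample `I ≥ 2` with
`P(I = i) = 1 / (c_ε i (log i)^{1+ε})`, then return `xi + 2^{I-2}` with probability `1/2`
and `xi − 2^{I-2}` otherwise. -/
noncomputable def htStepP (ε : ℝ) (xi z : ℤ) : ℝ≥0∞ :=
  ∑' i : ℕ, if 2 ≤ i ∧ (z = xi + 2 ^ (i - 2) ∨ z = xi - 2 ^ (i - 2)) then
    ENNReal.ofReal (1 / (2 * (cEps ε * i * Real.log i ^ (1 + ε)))) else 0

/-- weight of a sign -/
noncomputable def pw (n : ℕ) (σ : SignType) : ℝ := if σ = 0 then 1 - 1 / (n : ℝ) else 1 / (2 * (n : ℝ))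

lemma sum_sign {M : Type*} [AddCommMonoid M] (f : SignType → M) :
    ∑ σ, f σ = f 0 + (f (-1) + f 1) := by
  rw [SignType.univ_eq]
  rw [Finset.sum_insert (by decide), Finset.sum_insert (by decide), Finset.sum_singleton]

lemma pw_nonneg {n : ℕ} (hn : 1 ≤ n) (σ : SignType) : 0 ≤ pw n σ := by
  unfold pw
  have h : (1 : ℝ) ≤ n := by exact_mod_cast hn
  split_ifs
  · rw [sub_nonneg, div_le_one (by linarith)]; exact h
  · positivity

lemma pw_sum {n : ℕ} (hn : 1 ≤ n) : ∑ σ, pw n σ = 1 := by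
  rw [sum_sign]
  have h : (1 : ℝ) ≤ n := by exact_mod_cast hn
  simp [pw]
  field_simp
  ring

/-- product weight -/
noncomputable def PW (n : ℕ) (s : Fin n → SignType) : ℝ := ∏ i, pw n (s i)

lemma PW_nonneg {n : ℕ} (hn : 1 ≤ n) (s : Fin n → SignType) : 0 ≤ PW n s :=
  Finset.prod_nonneg fun _ _ => pw_nonneg hn _

lemma PW_sum {n : ℕ} (hn : 1 ≤ n) : ∑ s, PW n s = 1 := by
  unfold PW
  rw [← Fintype.prod_sum (fun (_ : Fin n) σ => pw n σ)]
  simp [pw_sum hn]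

lemma PW_marg {n : ℕ} (hn : 1 ≤ n) (i : Fin n) :
    ∑ s, PW n s * (if s i ≠ 0 then 1 else 0) = 1 / (n : ℝ) := by
  have key : ∀ s : Fin n → SignType, PW n s * (if s i ≠ 0 then 1 else 0)
      = ∏ j, (if j = i then (if s j ≠ 0 then pw n (s j) else 0) else pw n (s j)) := by
    intro s
    unfold PW
    rw [← Finset.mul_prod_erase _ _ (Finset.mem_univ i),
      ← Finset.mul_prod_erase Finset.univ (fun j => ite _ _ _) (Finset.mem_univ i)]
    rw [Finset.prod_congr rfl (g := fun j => if j = i then (if s j ≠ 0 then pw n (s j) else 0) else pw n (s j))]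
    · simp
    · intro j hj
      rw [if_neg (Finset.ne_of_mem_erase hj)]
  simp_rw [key]
  rw [← Fintype.prod_sum (fun (j : Fin n) σ => if j = i then (if σ ≠ 0 then pw n σ else 0) else pw n σ)]
  rw [Finset.prod_eq_single i]
  · rw [sum_sign]
    simp [pw]
    have h : (1 : ℝ) ≤ n := by exact_mod_cast hn
    field_simp
    ring
  · intro j _ hj
    simp only [if_neg hj]
    exact pw_sum hn
  · simp

lemma PW_single {n : ℕ} (i : Fin n) (σ : SignType) (hσ : σ ≠ 0) :
    PW n (Function.update (0 : Fin n → SignType) i σ) = 1 / (2 * (n : ℝ)) * (1 - 1 / (n : ℝ)) ^ (n - 1) := by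
  unfold PW
  rw [← Finset.mul_prod_erase _ _ (Finset.mem_univ i)]
  rw [Finset.prod_congr rfl (g := fun _ => (1 - 1 / (n : ℝ)))]
  · simp [pw, hσ]
  · intro j hj
    rw [Function.update_of_ne (Finset.ne_of_mem_erase hj)]
    simp [pw]

lemma q_ge {n : ℕ} (hn : 1 ≤ n) : (1 : ℝ) / 3 ≤ (1 - 1 / (n : ℝ)) ^ (n - 1) := by
  obtain ⟨m, rfl⟩ : ∃ m, n = m + 1 := ⟨n - 1, by omega⟩
  rcases Nat.eq_zero_or_pos m with rfl | hm
  · norm_num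
  have hm' : (0 : ℝ) < m := by exact_mod_cast hm
  have e : (1 - 1 / ((m + 1 : ℕ) : ℝ)) = (1 + 1 / (m : ℝ))⁻¹ := by
    push_cast; field_simp; ring
  rw [e, inv_pow, Nat.add_sub_cancel, one_div]
  apply inv_anti₀ (by positivity)
  have h1 : 1 + 1 / (m : ℝ) ≤ Real.exp (1 / m) := by
    have := Real.add_one_le_exp (1 / (m : ℝ)); linarith
  calc (1 + 1 / (m : ℝ)) ^ m ≤ (Real.exp (1 / m)) ^ m := by gcongr
    _ = Real.exp 1 := by rw [← Real.exp_nat_mul]; congr 1; field_simp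
    _ ≤ 3 := by linarith [Real.exp_one_lt_d9]

lemma coord_eq {n : ℕ} (hn : 1 ≤ n) (x z : ℤ) : coordMutP n pmStepP x z =
    ∑ σ : SignType, ENNReal.ofReal (pw n σ) * (if z = x + (σ : ℤ) then 1 else 0) := by
  rw [sum_sign]
  have h : (1 : ℝ) ≤ n := by exact_mod_cast hn
  have h0 : ENNReal.ofReal (pw n 0) = 1 - 1 / (n : ℝ≥0∞) := by
    simp only [pw, if_true]
    rw [ENNReal.ofReal_sub _ (by positivity), ENNReal.ofReal_one, ENNReal.ofReal_div_of_pos (by linarith)]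
    simp
  have h1 : ∀ σ : SignType, σ ≠ 0 → ENNReal.ofReal (pw n σ) = 1 / (n : ℝ≥0∞) * (1 / 2) := by
    intro σ hσ
    simp only [pw, if_neg hσ]
    rw [show 1 / (2 * (n : ℝ)) = (1 / n) * (1 / 2) by field_simp, ENNReal.ofReal_mul (by positivity),
      ENNReal.ofReal_div_of_pos (by linarith), ENNReal.ofReal_div_of_pos (by norm_num)]
    simp
  rw [h0, h1 _ (by decide), h1 _ (by decide)]
  unfold coordMutP pmStepP
  have c0 : (if z = x + ((0 : SignType) : ℤ) then (1 : ℝ≥0∞) else 0) = if z = x then 1 else 0 :=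
    if_congr (by simp) rfl rfl
  have c1 : (if z = x + ((1 : SignType) : ℤ) then (1 : ℝ≥0∞) else 0) = if z = x + 1 then 1 else 0 :=
    if_congr (by simp) rfl rfl
  have c2 : (if z = x + ((-1 : SignType) : ℤ) then (1 : ℝ≥0∞) else 0) = if z = x - 1 then 1 else 0 :=
    if_congr (by simp [sub_eq_add_neg]) rfl rfl
  rw [c0, c1, c2]
  rw [mul_add, add_comm (1 / (n : ℝ≥0∞) * _)]
  split_ifs <;> simp

/-- offspring -/
def off {n : ℕ} (x : Fin n → ℤ) (s : Fin n → SignType) : Fin n → ℤ := fun i => x i + (s i : ℤ)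

lemma mut_eq {n : ℕ} (hn : 1 ≤ n) (x y : Fin n → ℤ) : mutP n pmStepP x y =
    ∑ s : Fin n → SignType, ENNReal.ofReal (PW n s) * (if y = off x s then 1 else 0) := by
  unfold mutP
  simp_rw [coord_eq hn]
  rw [Fintype.prod_sum]
  refine Finset.sum_congr rfl fun s _ => ?_
  rw [Finset.prod_mul_distrib, PW, ENNReal.ofReal_prod_of_nonneg (fun i _ => pw_nonneg hn _)]
  congr 1
  rw [Finset.prod_boole]
  simp [funext_iff, off]

lemma mut_tsum {n : ℕ} (hn : 1 ≤ n) (x : Fin n → ℤ) (F : (Fin n → ℤ) → ℝ≥0∞) :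
    ∑' y, mutP n pmStepP x y * F y = ∑ s : Fin n → SignType, ENNReal.ofReal (PW n s) * F (off x s) := by
  simp_rw [mut_eq hn, Finset.sum_mul]
  rw [Summable.tsum_finsetSum (fun _ _ => ENNReal.summable)]
  refine Finset.sum_congr rfl fun s _ => ?_
  rw [tsum_eq_single (off x s)]
  · simp
  · intro y hy; simp [hy]

lemma trans_tsum {n : ℕ} (hn : 1 ≤ n) (a x : Fin n → ℤ) (F : (Fin n → ℤ) → ℝ≥0∞) :
    ∑' y, transP n a pmStepP x y * F y = ∑ s : Fin n → SignType, ENNReal.ofReal (PW n s) *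
      (if fitness a (off x s) ≤ fitness a x then F (off x s) else F x) := by
  unfold transP
  simp_rw [add_mul]
  rw [ENNReal.tsum_add]
  have e1 : ∑' y, (if fitness a y ≤ fitness a x then mutP n pmStepP x y else 0) * F y =
      ∑ s : Fin n → SignType, ENNReal.ofReal (PW n s) *
      (if fitness a (off x s) ≤ fitness a x then F (off x s) else 0) := by
    rw [← mut_tsum hn x (fun y => if fitness a y ≤ fitness a x then F y else 0)]
    refine tsum_congr fun y => ?_
    split_ifs <;> simp
  have e2 : ∑' y, (if y = x then ∑' z : Fin n → ℤ,
      (if fitness a x < fitness a z then mutP n pmStepP x z else 0) else 0) * F y =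
      ∑ s : Fin n → SignType, ENNReal.ofReal (PW n s) *
      (if fitness a (off x s) ≤ fitness a x then 0 else F x) := by
    rw [tsum_eq_single x (by intro y hy; simp [hy])]
    rw [← mut_tsum hn x (fun y => if fitness a y ≤ fitness a x then 0 else F x), if_pos rfl,
      ← ENNReal.tsum_mul_right]
    refine tsum_congr fun y => ?_
    by_cases h : fitness a y ≤ fitness a x
    · simp [h]
    · simp [h, not_le.mp h]
  rw [e1, e2, ← Finset.sum_add_distrib]
  refine Finset.sum_congr rfl fun s _ => ?_
  rw [← mul_add]
  split_ifs <;> simp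

lemma iter_bound {n : ℕ} (a : Fin n → ℤ) (V : (Fin n → ℤ) → ℝ≥0∞) (ρ : ℝ≥0∞)
    (h : ∀ x, ∑' y, transP n a pmStepP x y * V y ≤ ρ * V x) (t : ℕ) :
    ∑' x, eaDist n a pmStepP t x * V x ≤ ρ ^ t * V (fun _ => 0) := by
  induction t with
  | zero =>
    rw [tsum_eq_single (fun _ => 0)]
    · simp [eaDist]
    · intro y hy; simp [eaDist, hy]
  | succ t ih =>
    simp only [eaDist]
    simp_rw [← ENNReal.tsum_mul_right]
    rw [ENNReal.tsum_comm]
    calc _ ≤ ∑' x, eaDist n a pmStepP t x * (ρ * V x) := by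
          refine ENNReal.tsum_le_tsum fun x => ?_
          simp_rw [mul_assoc]
          rw [ENNReal.tsum_mul_left]
          gcongr
          exact h x
      _ = ρ * ∑' x, eaDist n a pmStepP t x * V x := by
          rw [← ENNReal.tsum_mul_left]
          refine tsum_congr fun x => by ring
      _ ≤ ρ * (ρ ^ t * V (fun _ => 0)) := by gcongr
      _ = _ := by ring

/-- distance in coordinate -/
def dd {n : ℕ} (a x : Fin n → ℤ) (i : Fin n) : ℕ := (x i - a i).natAbs

lemma fit_split {n : ℕ} (a y z : Fin n → ℤ) (i : Fin n) (h : ∀ j, j ≠ i → y j = z j) :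
    fitness a y + dd a z i = fitness a z + dd a y i := by
  unfold fitness dd
  rw [← Finset.add_sum_erase _ _ (Finset.mem_univ i),
    ← Finset.add_sum_erase Finset.univ (fun i => (z i - a i).natAbs) (Finset.mem_univ i)]
  rw [Finset.sum_congr rfl (g := fun j => (z j - a j).natAbs)]
  · ring
  · intro j hj
    rw [h j (Finset.ne_of_mem_erase hj)]

/-- flip coordinate `i` -/
def flip' {n : ℕ} (i : Fin n) (s : Fin n → SignType) : Fin n → SignType := Function.update s i (-s i)

lemma flip_invol {n : ℕ} (i : Fin n) (s : Fin n → SignType) : flip' i (flip' i s) = s := by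
  unfold flip'
  ext j
  by_cases h : j = i
  · subst h; simp
  · simp [h]

lemma pw_neg (n : ℕ) (σ : SignType) : pw n (-σ) = pw n σ := by
  unfold pw
  cases σ <;> simp

lemma PW_flip {n : ℕ} (i : Fin n) (s : Fin n → SignType) : PW n (flip' i s) = PW n s := by
  unfold PW flip'
  refine Finset.prod_congr rfl fun j _ => ?_
  by_cases h : j = i
  · subst h; simp [pw_neg]
  · simp [h]

/-- reduced potential -/
noncomputable def psi (d : ℕ) : ℝ := (7 / 6 : ℝ) ^ d - d / 6

lemma psi_succ (d : ℕ) : psi (d + 1) - psi d = ((7 / 6 : ℝ) ^ d - 1) / 6 := by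
  unfold psi; push_cast; ring

/-- contribution -/
noncomputable def gg {n : ℕ} (a x : Fin n → ℤ) (i : Fin n) (s : Fin n → SignType) : ℝ :=
  PW n s * (if fitness a (off x s) ≤ fitness a x then psi (dd a (off x s) i) - psi (dd a x i) else 0)

lemma core_up {n : ℕ} (hn : 1 ≤ n) (a x : Fin n → ℤ) (i : Fin n) (e : ℕ) (hd : dd a x i = e + 1)
    (u : Fin n → SignType) (h1 : dd a (off x u) i = e + 2) (h2 : dd a (off x (flip' i u)) i = e) :
    gg a x i u + gg a x i (flip' i u) ≤ PW n u * ((7 / 6 : ℝ) ^ e / 36)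
      - (if u = Function.update (0 : Fin n → SignType) i (u i) then PW n u * (((7 / 6 : ℝ) ^ e - 1) / 6) else 0) := by
  have hP := PW_nonneg hn u
  have hw : (1 : ℝ) ≤ (7 / 6 : ℝ) ^ e := one_le_pow₀ (by norm_num)
  have e1 : psi (e + 2) - psi (e + 1) = ((7 / 6 : ℝ) ^ (e + 1) - 1) / 6 := psi_succ (e + 1)
  have e2 : psi e - psi (e + 1) = - (((7 / 6 : ℝ) ^ e - 1) / 6) := by rw [← psi_succ e]; ring
  have hf := fit_split a (off x u) (off x (flip' i u)) i (by
    intro j hj; simp [off, flip', hj])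
  unfold gg
  rw [PW_flip, h1, h2, hd, e1, e2, pow_succ]
  rw [h1, h2] at hf
  generalize (7 / 6 : ℝ) ^ e = W at *
  generalize PW n u = P at *
  have hPW : 0 ≤ P * (W - 1) := mul_nonneg hP (by linarith)
  split_ifs with a1 a2 a3 a2 a3 a3
  all_goals try (exfalso; omega)
  · exfalso
    have := fit_split a (off x u) x i (by
      intro j hj; rw [a3]; simp [off, hj])
    rw [h1, hd] at this
    omega
  · nlinarith
  · nlinarith
  · nlinarith
  · exfalso
    have := fit_split a (off x u) x i (by
      intro j hj; rename_i a3; rw [a3]; simp [off, hj])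
    rw [h1, hd] at this
    omega
  · nlinarith

lemma coord_drift {n : ℕ} (hn : 1 ≤ n) (a x : Fin n → ℤ) (i : Fin n) (e : ℕ) (hd : dd a x i = e + 1) :
    ∑ s, gg a x i s ≤ 1 / (2 * (n : ℝ)) * ((7 / 6 : ℝ) ^ e / 36 -
      (1 - 1 / (n : ℝ)) ^ (n - 1) * (((7 / 6 : ℝ) ^ e - 1) / 6)) := by
  have hflip : ∑ s, gg a x i (flip' i s) = ∑ s, gg a x i s :=
    Equiv.sum_comp (Function.Involutive.toPerm (flip' i) (flip_invol i)) (gg a x i)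
  have hpt : ∀ s, gg a x i s + gg a x i (flip' i s) ≤
      PW n s * (if s i ≠ 0 then 1 else 0) * ((7 / 6 : ℝ) ^ e / 36)
      - ((if s = Function.update (0 : Fin n → SignType) i 1 then PW n (Function.update (0 : Fin n → SignType) i 1) * (((7 / 6 : ℝ) ^ e - 1) / 6) else 0)
       + (if s = Function.update (0 : Fin n → SignType) i (-1) then PW n (Function.update (0 : Fin n → SignType) i (-1)) * (((7 / 6 : ℝ) ^ e - 1) / 6) else 0)) := by
    intro s
    have conv : s i ≠ 0 → ((if s = Function.update (0 : Fin n → SignType) i 1 then PW n (Function.update (0 : Fin n → SignType) i 1) * (((7 / 6 : ℝ) ^ e - 1) / 6) else 0)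
       + (if s = Function.update (0 : Fin n → SignType) i (-1) then PW n (Function.update (0 : Fin n → SignType) i (-1)) * (((7 / 6 : ℝ) ^ e - 1) / 6) else 0))
       = (if s = Function.update (0 : Fin n → SignType) i (s i) then PW n s * (((7 / 6 : ℝ) ^ e - 1) / 6) else 0) := by
      intro hs
      have key : ∀ σ, s = Function.update (0 : Fin n → SignType) i σ → s i = σ := by
        intro σ h; rw [h]; simp
      have hs' : s i = 1 ∨ s i = -1 := by
        revert hs; generalize s i = σ; revert σ; decide
      rcases hs' with h | h
      · rw [if_neg (c := s = Function.update (0 : Fin n → SignType) i (-1)), add_zero, h]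
        · split_ifs with h'
          · rw [← h']
          · rfl
        · intro h'; have := key _ h'; rw [h] at this; exact absurd this (by decide)
      · rw [if_neg (c := s = Function.update (0 : Fin n → SignType) i 1), zero_add, h]
        · split_ifs with h'
          · rw [← h']
          · rfl
        · intro h'; have := key _ h'; rw [h] at this; exact absurd this (by decide)
    by_cases hs : s i = 0
    · have hfs : flip' i s = s := by
        unfold flip'; rw [hs]; ext j
        by_cases h : j = i
        · subst h; simp [hs]
        · simp [h]
      have hg : gg a x i s = 0 := by
        unfold gg dd off; simp [hs]
      have key : ∀ σ, σ ≠ 0 → ¬ s = Function.update (0 : Fin n → SignType) i σ := by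
        intro σ h h'; apply h; rw [← hs, h']; simp
      rw [hfs, hg, if_neg (key _ (by decide)), if_neg (key _ (by decide))]
      simp [hs]
    · rw [conv hs]
      have hcase : (dd a (off x s) i = e + 2 ∧ dd a (off x (flip' i s)) i = e) ∨
          (dd a (off x s) i = e ∧ dd a (off x (flip' i s)) i = e + 2) := by
        have hs' : s i = 1 ∨ s i = -1 := by
          revert hs; generalize s i = σ; revert σ; decide
        unfold dd at hd ⊢
        rcases hs' with h | h <;> simp [off, flip', h] <;> omega
      simp only [ne_eq, hs, not_false_eq_true, if_true, mul_one]
      rcases hcase with ⟨h1, h2⟩ | ⟨h1, h2⟩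
      · exact core_up hn a x i e hd s h1 h2
      · have := core_up hn a x i e hd (flip' i s) h2 (by rw [flip_invol]; exact h1)
        rw [flip_invol, PW_flip] at this
        have iso : (flip' i s = Function.update (0 : Fin n → SignType) i (flip' i s i)) ↔ (s = Function.update (0 : Fin n → SignType) i (s i)) := by
          simp only [funext_iff]
          refine forall_congr' fun j => ?_
          by_cases h : j = i
          · subst h; simp
          · simp [flip', h]
        simp only [iso] at this
        linarith
  have hsum := Finset.sum_le_sum (s := Finset.univ) fun s _ => hpt s
  rw [Finset.sum_add_distrib, hflip, Finset.sum_sub_distrib, Finset.sum_add_distrib, ← Finset.sum_mul,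
    PW_marg hn] at hsum
  simp only [Finset.sum_ite_eq', Finset.mem_univ, if_true] at hsum
  rw [PW_single _ _ (by decide), PW_single _ _ (by decide)] at hsum
  have h : (1 : ℝ) ≤ n := by exact_mod_cast hn
  generalize (1 - 1 / (n : ℝ)) ^ (n - 1) = q at *
  have e3 : 1 / (2 * (n : ℝ)) = (1 / n) / 2 := by field_simp
  rw [e3] at hsum ⊢
  linarith

lemma coord_zero {n : ℕ} (a x : Fin n → ℤ) (i : Fin n) (hd : dd a x i = 0) (s) :
    gg a x i s = 0 := by
  have h : dd a (off x s) i = 0 ∨ dd a (off x s) i = 1 := by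
    unfold dd at *
    have : s i = 0 ∨ s i = 1 ∨ s i = -1 := by generalize s i = σ; revert σ; decide
    rcases this with h | h | h <;> simp [off, h] <;> omega
  unfold gg
  rw [hd]
  rcases h with h | h <;> rw [h] <;> simp [psi] <;> norm_num

lemma fit_drift {n : ℕ} (hn : 1 ≤ n) (a x : Fin n → ℤ) :
    ∑ s, PW n s * (if fitness a (off x s) ≤ fitness a x then
      (fitness a (off x s) : ℝ) - fitness a x else 0) ≤
    - ∑ i ∈ Finset.univ.filter (fun i => dd a x i ≠ 0),
      1 / (2 * (n : ℝ)) * (1 - 1 / (n : ℝ)) ^ (n - 1) := by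
  let D : Fin n → (Fin n → SignType) := fun i => Function.update (0 : Fin n → SignType) i (-SignType.sign (x i - a i))
  set h : (Fin n → SignType) → ℝ := fun s => PW n s * (if fitness a (off x s) ≤ fitness a x then
      (fitness a (off x s) : ℝ) - fitness a x else 0) with hh
  have hsg : ∀ i, dd a x i ≠ 0 → -SignType.sign (x i - a i) ≠ 0 := by
    intro i hi
    unfold dd at hi
    intro h0
    apply hi
    have : SignType.sign (x i - a i) = 0 := by
      revert h0; generalize SignType.sign (x i - a i) = σ; revert σ; decide
    rw [sign_eq_zero_iff] at this
    rw [this]; rfl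
  have hinj : Set.InjOn D (Finset.univ.filter (fun i => dd a x i ≠ 0)) := by
    intro i hi j hj hij
    by_contra hne
    have := congrFun hij i
    simp only [D, Function.update_self, Function.update_of_ne hne] at this
    exact hsg i (by simpa using hi) this
  have hval : ∀ i, dd a x i ≠ 0 → h (D i) = - (1 / (2 * (n : ℝ)) * (1 - 1 / (n : ℝ)) ^ (n - 1)) := by
    intro i hi
    have hf := fit_split a (off x (D i)) x i (by
      intro j hj; simp [off, D, hj])
    have hdd : dd a (off x (D i)) i + 1 = dd a x i := by
      unfold dd at *
      simp only [off, D, Function.update_self]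
      rcases lt_trichotomy (x i - a i) 0 with h | h | h
      · rw [sign_neg h]; simp; omega
      · exfalso; apply hi; rw [h]; rfl
      · rw [sign_pos h]; simp; omega
    have hfit : fitness a (off x (D i)) + 1 = fitness a x := by omega
    simp only [hh]
    rw [if_pos (by omega), PW_single _ _ (hsg i hi), ← hfit]
    push_cast; ring
  rw [← Finset.sum_neg_distrib, ← Finset.sum_congr rfl (fun i hi => hval i (Finset.mem_filter.mp hi).2),
    ← Finset.sum_image (f := h) hinj]
  rw [← neg_le_neg_iff, ← Finset.sum_neg_distrib, ← Finset.sum_neg_distrib]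
  apply Finset.sum_le_sum_of_subset_of_nonneg (Finset.subset_univ _)
  intro s _ _
  simp only [hh]
  have hP := PW_nonneg hn s
  split_ifs with hacc
  · have : (fitness a (off x s) : ℝ) ≤ fitness a x := by exact_mod_cast hacc
    nlinarith
  · simp

/-- the potential -/
noncomputable def Phi {n : ℕ} (a x : Fin n → ℤ) : ℝ := ∑ i, ((7 / 6 : ℝ) ^ (dd a x i) - 1)

lemma Phi_diff {n : ℕ} (a x y : Fin n → ℤ) : Phi a y - Phi a x =
    ∑ i, (psi (dd a y i) - psi (dd a x i)) + (1 / 6) * ((fitness a y : ℝ) - fitness a x) := by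
  have hf : ∀ z, (fitness a z : ℝ) = ∑ i, (dd a z i : ℝ) := by
    intro z; unfold fitness dd; push_cast; rfl
  rw [hf, hf, Phi, Phi, ← Finset.sum_sub_distrib, ← Finset.sum_sub_distrib, Finset.mul_sum,
    ← Finset.sum_add_distrib]
  refine Finset.sum_congr rfl fun i _ => ?_
  unfold psi; ring

lemma drift_real {n : ℕ} (hn : 1 ≤ n) (a x : Fin n → ℤ) :
    ∑ s, PW n s * (if fitness a (off x s) ≤ fitness a x then Phi a (off x s) - Phi a x else 0) ≤
      - (1 / (84 * (n : ℝ)) * Phi a x) := by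
  have e1 : ∀ s, PW n s * (if fitness a (off x s) ≤ fitness a x then Phi a (off x s) - Phi a x else 0)
      = ∑ i, gg a x i s + (1 / 6) * (PW n s * (if fitness a (off x s) ≤ fitness a x then
      (fitness a (off x s) : ℝ) - fitness a x else 0)) := by
    intro s
    unfold gg
    rw [← Finset.mul_sum]
    split_ifs
    · rw [Phi_diff]; ring
    · simp
  simp_rw [e1]
  rw [Finset.sum_add_distrib, Finset.sum_comm, ← Finset.mul_sum]
  have h2 := fit_drift hn a x
  rw [Finset.sum_filter] at h2
  have hq := q_ge hn
  have h1 : ∀ i, ∑ s, gg a x i s ≤ - (1 / (84 * (n : ℝ)) * ((7 / 6 : ℝ) ^ (dd a x i) - 1)) +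
      (1 / 6) * (if dd a x i ≠ 0 then 1 / (2 * (n : ℝ)) * (1 - 1 / (n : ℝ)) ^ (n - 1) else 0) := by
    intro i
    by_cases hd : dd a x i = 0
    · simp [coord_zero a x i hd, hd]
    · obtain ⟨e, he⟩ := Nat.exists_eq_succ_of_ne_zero hd
      have := coord_drift hn a x i e he
      rw [if_pos hd, he]
      refine this.trans ?_
      have h : (1 : ℝ) ≤ n := by exact_mod_cast hn
      have hw : (1 : ℝ) ≤ (7 / 6 : ℝ) ^ e := one_le_pow₀ (by norm_num)
      rw [Nat.succ_eq_add_one, pow_succ]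
      generalize (1 - 1 / (n : ℝ)) ^ (n - 1) = q at *
      generalize (7 / 6 : ℝ) ^ e = W at *
      have e3 : 1 / (2 * (n : ℝ)) = (1 / n) / 2 := by field_simp
      have e4 : 1 / (84 * (n : ℝ)) = (1 / n) / 84 := by field_simp
      rw [e3, e4]
      have hr : 0 ≤ 1 / (n : ℝ) := by positivity
      generalize 1 / (n : ℝ) = r at *
      have : 0 ≤ r * (W * (q - 1 / 3)) := mul_nonneg hr (mul_nonneg (by linarith) (by linarith))
      nlinarith
  have h3 := Finset.sum_le_sum (s := Finset.univ) fun i _ => h1 i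
  rw [Finset.sum_add_distrib, Finset.sum_neg_distrib, ← Finset.mul_sum, ← Finset.mul_sum] at h3
  unfold Phi
  linarith

lemma Phi_nonneg {n : ℕ} (a x : Fin n → ℤ) : 0 ≤ Phi a x :=
  Finset.sum_nonneg fun i _ => by
    have hw : (1 : ℝ) ≤ (7 / 6 : ℝ) ^ (dd a x i) := one_le_pow₀ (by norm_num)
    linarith

lemma Phi_min {n : ℕ} (a x : Fin n → ℤ) (h : fitness a x ≠ 0) : 1 ≤ 6 * Phi a x := by
  obtain ⟨i, _, hi⟩ := Finset.exists_ne_zero_of_sum_ne_zero h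
  have h1 : (7 / 6 : ℝ) ^ (dd a x i) - 1 ≤ Phi a x :=
    Finset.single_le_sum (f := fun i => (7 / 6 : ℝ) ^ (dd a x i) - 1) (fun i _ => by
      have hw : (1 : ℝ) ≤ (7 / 6 : ℝ) ^ (dd a x i) := one_le_pow₀ (by norm_num)
      linarith) (Finset.mem_univ i)
  have h2 : (7 / 6 : ℝ) ^ 1 ≤ (7 / 6 : ℝ) ^ (dd a x i) :=
    pow_le_pow_right₀ (by norm_num) (Nat.one_le_iff_ne_zero.mpr hi)
  linarith

lemma Phi_init {n : ℕ} (a : Fin n → ℤ) :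
    Phi a (fun _ => 0) ≤ normH a * (7 / 6 : ℝ) ^ (normInf a) := by
  unfold Phi normH
  rw [← nsmul_eq_mul, ← Finset.sum_const, Finset.sum_filter]
  refine Finset.sum_le_sum fun i _ => ?_
  split_ifs with h
  · have : dd a (fun _ => 0) i ≤ normInf a := by
      unfold dd normInf
      simp only [zero_sub, Int.natAbs_neg]
      exact Finset.le_sup (f := fun i => (a i).natAbs) (Finset.mem_univ i)
    have := pow_le_pow_right₀ (show (1 : ℝ) ≤ 7 / 6 by norm_num) this
    linarith
  · simp only [ne_eq, not_not] at h
    simp [dd, h]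

lemma drift_enn {n : ℕ} (hn : 1 ≤ n) (a x : Fin n → ℤ) :
    ∑' y, transP n a pmStepP x y * ENNReal.ofReal (Phi a y) ≤
      ENNReal.ofReal (1 - 1 / (84 * (n : ℝ))) * ENNReal.ofReal (Phi a x) := by
  rw [trans_tsum hn]
  have h : (1 : ℝ) ≤ n := by exact_mod_cast hn
  have hpos : 0 ≤ 1 - 1 / (84 * (n : ℝ)) := by
    rw [sub_nonneg, div_le_one (by linarith)]; linarith
  rw [← ENNReal.ofReal_mul hpos]
  have e : ∀ s, ENNReal.ofReal (PW n s) * (if fitness a (off x s) ≤ fitness a x then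
      ENNReal.ofReal (Phi a (off x s)) else ENNReal.ofReal (Phi a x)) =
      ENNReal.ofReal (PW n s * (if fitness a (off x s) ≤ fitness a x then
        (Phi a (off x s)) else (Phi a x))) := by
    intro s
    rw [ENNReal.ofReal_mul (PW_nonneg hn s)]
    split_ifs <;> rfl
  simp_rw [e]
  rw [← ENNReal.ofReal_sum_of_nonneg]
  · apply ENNReal.ofReal_le_ofReal
    have := drift_real hn a x
    have e2 : ∀ s, PW n s * (if fitness a (off x s) ≤ fitness a x then
        (Phi a (off x s)) else (Phi a x)) = PW n s * (if fitness a (off x s) ≤ fitness a x then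
        (Phi a (off x s)) - Phi a x else 0) + PW n s * Phi a x := by
      intro s; split_ifs <;> ring
    simp_rw [e2]
    rw [Finset.sum_add_distrib, ← Finset.sum_mul, PW_sum hn]
    linarith
  · intro s _
    refine mul_nonneg (PW_nonneg hn s) ?_
    split_ifs <;> exact Phi_nonneg _ _

lemma mass_enn {n : ℕ} (hn : 1 ≤ n) (a x : Fin n → ℤ) :
    ∑' y, transP n a pmStepP x y * (1 : ℝ≥0∞) ≤ 1 * 1 := by
  rw [trans_tsum hn a x (fun _ => 1)]
  simp only [ite_self, mul_one]
  rw [← ENNReal.ofReal_sum_of_nonneg (fun s _ => PW_nonneg hn s), PW_sum hn]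
  simp

lemma tail_one {n : ℕ} (hn : 1 ≤ n) (a : Fin n → ℤ) (t : ℕ) :
    (∑' x : Fin n → ℤ, if fitness a x = 0 then 0 else eaDist n a pmStepP t x) ≤ 1 := by
  have := iter_bound a (fun _ => 1) 1 (mass_enn hn a) t
  simp only [mul_one, one_pow] at this
  refine le_trans (ENNReal.tsum_le_tsum fun x => ?_) this
  split_ifs <;> simp

lemma tail_geo {n : ℕ} (hn : 1 ≤ n) (a : Fin n → ℤ) (t : ℕ) :
    (∑' x : Fin n → ℤ, if fitness a x = 0 then 0 else eaDist n a pmStepP t x) ≤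
      ENNReal.ofReal ((1 - 1 / (84 * (n : ℝ))) ^ t * (6 * Phi a (fun _ => 0))) := by
  have h : (1 : ℝ) ≤ n := by exact_mod_cast hn
  have hpos : 0 ≤ 1 - 1 / (84 * (n : ℝ)) := by
    rw [sub_nonneg, div_le_one (by linarith)]; linarith
  have := iter_bound a (fun x => ENNReal.ofReal (Phi a x)) _ (drift_enn hn a) t
  calc _ ≤ ∑' x, 6 * (eaDist n a pmStepP t x * ENNReal.ofReal (Phi a x)) := by
        refine ENNReal.tsum_le_tsum fun x => ?_
        split_ifs with hf
        · simp
        · have h1 : (1 : ℝ≥0∞) ≤ 6 * ENNReal.ofReal (Phi a x) := by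
            have := ENNReal.ofReal_le_ofReal (Phi_min a x hf)
            rw [ENNReal.ofReal_mul (by norm_num)] at this
            simpa using this
          calc _ = eaDist n a pmStepP t x * 1 := by rw [mul_one]
            _ ≤ eaDist n a pmStepP t x * (6 * ENNReal.ofReal (Phi a x)) := by gcongr
            _ = _ := by ring
    _ = 6 * ∑' x, (eaDist n a pmStepP t x * ENNReal.ofReal (Phi a x)) := ENNReal.tsum_mul_left
    _ ≤ 6 * (ENNReal.ofReal (1 - 1 / (84 * (n : ℝ))) ^ t * ENNReal.ofReal (Phi a fun _ => 0)) := by gcongr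
    _ = _ := by
        rw [ENNReal.ofReal_mul (by positivity), ENNReal.ofReal_mul (by norm_num), ENNReal.ofReal_pow hpos]
        simp only [ENNReal.ofReal_ofNat]
        ring

lemma time_bound (P : ℕ → ℝ≥0∞) (δ K : ℝ) (hδ : 0 < δ) (hδ1 : δ ≤ 1) (hK : 0 ≤ K)
    (h1 : ∀ t, P t ≤ 1) (h2 : ∀ t, P t ≤ ENNReal.ofReal ((1 - δ) ^ t * K)) (t0 : ℕ)
    (ht0 : (1 - δ) ^ t0 * K ≤ 1) : ∑' t, P t ≤ ENNReal.ofReal (t0 + 1 / δ) := by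
  have hr : 0 ≤ 1 - δ := by linarith
  rw [← (ENNReal.summable (f := fun t => P (t + t0))).sum_add_tsum_nat_add']
  rw [ENNReal.ofReal_add (by positivity) (by positivity)]
  refine add_le_add ?_ ?_
  · calc _ ≤ ∑ t ∈ Finset.range t0, (1 : ℝ≥0∞) := Finset.sum_le_sum fun t _ => h1 t
      _ = _ := by simp
  · calc _ ≤ ∑' t, ENNReal.ofReal ((1 - δ) ^ t) := by
          refine ENNReal.tsum_le_tsum fun t => (h2 _).trans (ENNReal.ofReal_le_ofReal ?_)
          rw [pow_add, mul_assoc]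
          exact mul_le_of_le_one_right (by positivity) ht0
      _ = ENNReal.ofReal (1 / δ) := by
          rw [← ENNReal.ofReal_tsum_of_nonneg (fun t => by positivity)
            (summable_geometric_of_lt_one hr (by linarith)),
            tsum_geometric_of_lt_one hr (by linarith)]
          congr 1; simp
      _ ≤ _ := le_rfl

/-- **Upper bound for the (1+1) EA with the ±1 operator.**
For every `a ∈ ℤⁿ \ {0ⁿ}`, the expected optimization time of the (1+1) EA with the `±1`
step operator, started at the all-`0` integer string, on `f_a` is
`O(n · (|a|_∞ + log |a|_H))`. -/
theorem ea_pm_upper_bound :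
    ∃ C : ℝ, 0 < C ∧ ∀ (n : ℕ) (a : Fin n → ℤ), a ≠ 0 →
      eaExpTime n a pmStepP ≤
        ENNReal.ofReal (C * n * ((normInf a : ℝ) + Real.log (normH a))) := by


  refine ⟨1000, by norm_num, fun n a ha => ?_⟩
  obtain ⟨i, hi⟩ : ∃ i, a i ≠ 0 := by
    by_contra hcon
    push Not at hcon
    exact ha (funext hcon)
  have hn : 1 ≤ n := Nat.one_le_iff_ne_zero.mpr (by rintro rfl; exact i.elim0)
  have h : (1 : ℝ) ≤ n := by exact_mod_cast hn
  have hH : 1 ≤ normH a := Finset.card_pos.mpr ⟨i, by simp [hi]⟩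
  have hH' : (1 : ℝ) ≤ normH a := by exact_mod_cast hH
  have hA : 1 ≤ normInf a := by
    have : (a i).natAbs ≤ normInf a :=
      Finset.le_sup (f := fun i => (a i).natAbs) (Finset.mem_univ i)
    omega
  have hA' : (1 : ℝ) ≤ normInf a := by exact_mod_cast hA
  have hlog : 0 ≤ Real.log (normH a) := Real.log_nonneg hH'
  set L : ℝ := 6 * normInf a + Real.log (normH a) with hL
  have hLpos : 0 ≤ L := by positivity
  have hK : 6 * Phi a (fun _ => 0) ≤ Real.exp L := by
    have h6 : (6 : ℝ) ≤ Real.exp 5 := by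
      have := Real.add_one_le_exp (5 : ℝ); linarith
    have h76 : (7 / 6 : ℝ) ≤ Real.exp 1 := by
      have := Real.add_one_le_exp (1 : ℝ); linarith
    calc 6 * Phi a (fun _ => 0) ≤ 6 * (normH a * (7 / 6 : ℝ) ^ (normInf a)) := by
          gcongr; exact Phi_init a
      _ ≤ Real.exp 5 * (Real.exp (Real.log (normH a)) * (Real.exp 1) ^ (normInf a)) := by
          rw [Real.exp_log (by linarith)]
          gcongr
      _ = Real.exp (5 + (Real.log (normH a) + normInf a)) := by
          rw [← Real.exp_nat_mul, ← Real.exp_add, ← Real.exp_add, mul_one]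
      _ ≤ Real.exp L := by
          apply Real.exp_le_exp.mpr; rw [hL]; linarith
  have hδ : 0 < 1 / (84 * (n : ℝ)) := by positivity
  have hδ1 : 1 / (84 * (n : ℝ)) ≤ 1 := by
    rw [div_le_one (by linarith)]; linarith
  have ht0 : (1 - 1 / (84 * (n : ℝ))) ^ ⌈84 * n * L⌉₊ * (6 * Phi a (fun _ => 0)) ≤ 1 := by
    have hle : 84 * n * L ≤ ⌈84 * n * L⌉₊ := Nat.le_ceil _
    calc _ ≤ (Real.exp (-(1 / (84 * (n : ℝ))))) ^ ⌈84 * n * L⌉₊ * Real.exp L := by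
          have := Phi_nonneg a (fun _ => 0)
          have h0 : 0 ≤ 1 - 1 / (84 * (n : ℝ)) := by linarith
          have := Real.add_one_le_exp (-(1 / (84 * (n : ℝ))))
          gcongr
          linarith
      _ = Real.exp (L - ⌈84 * n * L⌉₊ * (1 / (84 * (n : ℝ)))) := by
          rw [← Real.exp_nat_mul, ← Real.exp_add]; congr 1; ring
      _ ≤ 1 := by
          rw [Real.exp_le_one_iff]
          have : L = 84 * n * L * (1 / (84 * (n : ℝ))) := by field_simp
          have := mul_le_mul_of_nonneg_right hle hδ.le
          linarith
  refine (time_bound _ (1 / (84 * (n : ℝ))) (6 * Phi a (fun _ => 0)) hδ hδ1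
    (by have := Phi_nonneg a (fun _ => 0); positivity) (tail_one hn a) (tail_geo hn a) _ ht0).trans ?_
  apply ENNReal.ofReal_le_ofReal
  have hc := (Nat.ceil_lt_add_one (show 0 ≤ 84 * (n : ℝ) * L by positivity)).le
  rw [one_div_one_div]
  have h1 : (n : ℝ) ≤ n * normInf a := le_mul_of_one_le_right (by linarith) hA'
  have h2 : 0 ≤ (n : ℝ) * Real.log (normH a) := by positivity
  have h3 : 84 * (n : ℝ) * L = 504 * (n * normInf a) + 84 * (n * Real.log (normH a)) := by
    rw [hL]; ring
  have h4 : 1000 * (n : ℝ) * (normInf a + Real.log (normH a)) =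
      1000 * (n * normInf a) + 1000 * (n * Real.log (normH a)) := by ring
  rw [h4]
  linarith
end

section
/- Drift of the exponential potential for the (1+1) EA with the ±1 operator: Fix ω > 1 with ω − 1 − e(ω−1)² > 0 and set c = (ω − 1 − e(ω−1)²)/e. For a ∈ ℤⁿ \ {0ⁿ}, define the potential g(x) = Σ_{i=1}^n (ω^{d_i} − 1) where d_i = |a_i − x_i|. Let x ∈ ℤⁿ with g(x) > 0 be the current search point of the (1+1) EA with the ±1 operator on f_a and let Y be the search point after one iteration of mutation and selection. Then E[g(x) − g(Y)] ≥ (c/(2ωn)) · g(x). -/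
open scoped ENNReal BigOperators

noncomputable def kR (n : ℕ) (xi z : ℤ) : ℝ :=
  (1 - 1 / (n : ℝ)) * (if z = xi then 1 else 0) +
    (1 / (n : ℝ)) * ((if z = xi + 1 then 1 / 2 else 0) + (if z = xi - 1 then 1 / 2 else 0))

noncomputable def pR {n : ℕ} (x y : Fin n → ℤ) : ℝ := ∏ i, kR n (x i) (y i)

def boxF {n : ℕ} (x : Fin n → ℤ) : Finset (Fin n → ℤ) :=
  Fintype.piFinset fun i => ({x i - 1, x i, x i + 1} : Finset ℤ)

lemma mem_boxF {n : ℕ} {x y : Fin n → ℤ} :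
    y ∈ boxF x ↔ ∀ i, y i = x i - 1 ∨ y i = x i ∨ y i = x i + 1 := by
  simp [boxF, Fintype.mem_piFinset]

lemma one_div_le_one {n : ℕ} (hn : 0 < n) : 1 / (n : ℝ) ≤ 1 := by
  have : (1 : ℝ) ≤ n := by exact_mod_cast hn
  rw [div_le_one (by linarith)]; exact this

lemma kR_nonneg {n : ℕ} (hn : 0 < n) (xi z : ℤ) : 0 ≤ kR n xi z := by
  have := one_div_le_one hn
  unfold kR
  have h1 : 0 ≤ 1 - 1 / (n : ℝ) := by linarith
  apply add_nonneg
  · apply mul_nonneg h1; split_ifs <;> norm_num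
  · apply mul_nonneg (by positivity); split_ifs <;> norm_num

lemma pR_nonneg {n : ℕ} (hn : 0 < n) (x y : Fin n → ℤ) : 0 ≤ pR x y :=
  Finset.prod_nonneg fun _ _ => kR_nonneg hn _ _

lemma coord_eq_s6 {n : ℕ} (hn : 0 < n) (xi z : ℤ) :
    coordMutP n pmStepP xi z = ENNReal.ofReal (kR n xi z) := by
  have h := one_div_le_one hn
  have hn' : (0 : ℝ) < n := by exact_mod_cast hn
  have h1 : 0 ≤ 1 - 1 / (n : ℝ) := by linarith
  have e1 : (1 / (n : ℝ≥0∞)) = ENNReal.ofReal (1 / (n : ℝ)) := by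
    rw [ENNReal.ofReal_div_of_pos hn']; simp
  have e2 : (1 - 1 / (n : ℝ≥0∞)) = ENNReal.ofReal (1 - 1 / (n : ℝ)) := by
    rw [ENNReal.ofReal_sub _ (by positivity), e1]; simp
  have e3 : (1 / 2 : ℝ≥0∞) = ENNReal.ofReal (1 / 2) := by
    rw [ENNReal.ofReal_div_of_pos (by norm_num)]; simp
  have n1 : (0 : ℝ) ≤ if z = xi then 1 else 0 := by split_ifs <;> norm_num
  have n2 : (0 : ℝ) ≤ if z = xi + 1 then 1 / 2 else 0 := by split_ifs <;> norm_num
  have n3 : (0 : ℝ) ≤ if z = xi - 1 then 1 / 2 else 0 := by split_ifs <;> norm_num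
  unfold coordMutP kR pmStepP
  rw [ENNReal.ofReal_add (mul_nonneg h1 n1) (mul_nonneg (by positivity) (add_nonneg n2 n3)),
    ENNReal.ofReal_mul h1, ENNReal.ofReal_mul (by positivity), ENNReal.ofReal_add n2 n3, e2, e1, e3]
  congr 2
  · split_ifs <;> simp
  · congr 1 <;> split_ifs <;> simp

lemma mutP_eq {n : ℕ} (hn : 0 < n) (x y : Fin n → ℤ) :
    mutP n pmStepP x y = ENNReal.ofReal (pR x y) := by
  unfold mutP pR
  rw [ENNReal.ofReal_prod_of_nonneg fun _ _ => kR_nonneg hn _ _]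
  exact Finset.prod_congr rfl fun i _ => coord_eq_s6 hn _ _

lemma pR_eq_zero {n : ℕ} {x y : Fin n → ℤ} (h : y ∉ boxF x) : pR x y = 0 := by
  rw [mem_boxF] at h
  push Not at h
  obtain ⟨i, h1, h2, h3⟩ := h
  apply Finset.prod_eq_zero (Finset.mem_univ i)
  simp [kR, h1, h2, h3]

lemma sum_three (z : ℤ) (f : ℤ → ℝ) :
    ∑ j ∈ ({z - 1, z, z + 1} : Finset ℤ), f j = f (z - 1) + (f z + f (z + 1)) := by
  rw [Finset.sum_insert, Finset.sum_insert, Finset.sum_singleton]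
  · simp
  · simp; omega

lemma kR_zero (n : ℕ) (z : ℤ) : kR n z z = 1 - 1 / (n : ℝ) := by
  have : ¬ (z = z - 1) := by omega
  simp [kR, this]
lemma kR_up (n : ℕ) (z : ℤ) : kR n z (z + 1) = 1 / (2 * (n : ℝ)) := by
  have : ¬ (z + 1 = z - 1) := by omega
  simp [kR, this] <;> ring
lemma kR_dn (n : ℕ) (z : ℤ) : kR n z (z - 1) = 1 / (2 * (n : ℝ)) := by
  have : ¬ (z - 1 = z + 1) := by omega
  simp [kR, this] <;> ring

lemma kR_sum (n : ℕ) (z : ℤ) :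
    ∑ j ∈ ({z - 1, z, z + 1} : Finset ℤ), kR n z j = 1 := by
  rw [sum_three, kR_zero, kR_up, kR_dn]; ring

lemma pR_sum {n : ℕ} (x : Fin n → ℤ) : ∑ y ∈ boxF x, pR x y = 1 := by
  unfold boxF pR
  rw [← Finset.prod_univ_sum (fun i => ({x i - 1, x i, x i + 1} : Finset ℤ))
    (fun i j => kR n (x i) j)]
  simp only [kR_sum, Finset.prod_const_one]

lemma pR_marg {n : ℕ} (x : Fin n → ℤ) (i : Fin n) (φ : ℤ → ℝ) :
    ∑ y ∈ boxF x, pR x y * φ (y i) =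
      ∑ j ∈ ({x i - 1, x i, x i + 1} : Finset ℤ), kR n (x i) j * φ j := by
  have e : ∀ y ∈ boxF x, pR x y * φ (y i) =
      ∏ k, (kR n (x k) (y k) * if k = i then φ (y k) else 1) := by
    intro y _
    rw [Finset.prod_mul_distrib, Finset.prod_ite_eq' Finset.univ i (fun k => φ (y k))]
    simp [pR]
  rw [Finset.sum_congr rfl e]
  unfold boxF
  rw [← Finset.prod_univ_sum (fun i => ({x i - 1, x i, x i + 1} : Finset ℤ))
    (fun k j => kR n (x k) j * if k = i then φ j else 1)]
  rw [Finset.prod_eq_single i]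
  · simp
  · intro b _ hb
    simp only [hb, if_false, mul_one, kR_sum]
  · simp

/-- coordinate progress -/
def tZ (α ξ z : ℤ) : ℤ := ((ξ - α).natAbs : ℤ) - ((z - α).natAbs : ℤ)

lemma tZ_sum {n : ℕ} (a x y : Fin n → ℤ) :
    ∑ i, tZ (a i) (x i) (y i) = (fitness a x : ℤ) - fitness a y := by
  simp [tZ, fitness, Finset.sum_sub_distrib]

lemma acc_iff {n : ℕ} (a x y : Fin n → ℤ) :
    fitness a y ≤ fitness a x ↔ 0 ≤ ∑ i, tZ (a i) (x i) (y i) := by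
  rw [tZ_sum]; omega

def flipC {n : ℕ} (x : Fin n → ℤ) (i : Fin n) (y : Fin n → ℤ) : Fin n → ℤ :=
  Function.update y i (2 * x i - y i)

lemma flip_mem {n : ℕ} {x : Fin n → ℤ} (i : Fin n) {y : Fin n → ℤ} (h : y ∈ boxF x) :
    flipC x i y ∈ boxF x := by
  rw [mem_boxF] at h ⊢
  intro j
  have := h j
  unfold flipC
  by_cases hj : j = i
  · subst hj; simp; omega
  · simpa [hj] using this

lemma flipC_flipC {n : ℕ} (x : Fin n → ℤ) (i : Fin n) (y : Fin n → ℤ) :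
    flipC x i (flipC x i y) = y := by
  unfold flipC; simp

lemma pR_flip {n : ℕ} (x : Fin n → ℤ) (i : Fin n) (y : Fin n → ℤ) :
    pR x (flipC x i y) = pR x y := by
  unfold pR
  apply Finset.prod_congr rfl
  intro j _
  unfold flipC
  by_cases hj : j = i
  · subst hj
    simp only [Function.update_self, kR]
    have e1 : (2 * x j - y j = x j) ↔ (y j = x j) := by omega
    have e2 : (2 * x j - y j = x j + 1) ↔ (y j = x j - 1) := by omega
    have e3 : (2 * x j - y j = x j - 1) ↔ (y j = x j + 1) := by omega
    simp only [e1, e2, e3]; ring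
  · simp [hj]

lemma sum_flip {n : ℕ} (x : Fin n → ℤ) (i : Fin n) (F : (Fin n → ℤ) → ℝ) :
    ∑ y ∈ boxF x, F (flipC x i y) = ∑ y ∈ boxF x, F y := by
  apply Finset.sum_nbij' (flipC x i) (flipC x i)
  · intro y h; exact flip_mem i h
  · intro y h; exact flip_mem i h
  · intro y _; exact flipC_flipC x i y
  · intro y _; exact flipC_flipC x i y
  · intro y _; rfl

/-- the acceptance indicator -/
noncomputable def accR {n : ℕ} (a x y : Fin n → ℤ) : ℝ :=
  if fitness a y ≤ fitness a x then 1 else 0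

/-- one coordinate moved towards the target -/
def eC {n : ℕ} (a x : Fin n → ℤ) (i : Fin n) : Fin n → ℤ :=
  Function.update x i (if a i < x i then x i - 1 else x i + 1)

lemma eC_mem {n : ℕ} (a x : Fin n → ℤ) (i : Fin n) : eC a x i ∈ boxF x := by
  rw [mem_boxF]; intro j
  unfold eC
  by_cases hj : j = i
  · subst hj; simp only [Function.update_self]; split_ifs <;> simp
  · simp [hj]

lemma eC_inj {n : ℕ} (a x : Fin n → ℤ) : Function.Injective (eC a x) := by
  intro i j h
  by_contra hij
  have := congrFun h i
  simp only [eC, Function.update_self, Function.update_of_ne hij] at this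
  split_ifs at this <;> omega

lemma eC_t {n : ℕ} (a x : Fin n → ℤ) (i : Fin n) (hi : x i ≠ a i) :
    tZ (a i) (x i) (eC a x i i) = 1 := by
  simp only [eC, Function.update_self, tZ]
  split_ifs <;> omega

lemma eC_t_ne {n : ℕ} (a x : Fin n → ℤ) (i j : Fin n) (hj : j ≠ i) :
    tZ (a j) (x j) (eC a x i j) = 0 := by
  simp [eC, hj, tZ]

lemma eC_sum {n : ℕ} (a x : Fin n → ℤ) (i : Fin n) (hi : x i ≠ a i) :
    ∑ j, tZ (a j) (x j) (eC a x i j) = 1 := by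
  rw [Finset.sum_eq_single i, eC_t a x i hi]
  · intro j _ hj; exact eC_t_ne a x i j hj
  · simp

lemma pR_eC {n : ℕ} (a x : Fin n → ℤ) (i : Fin n) :
    pR x (eC a x i) = 1 / (2 * (n : ℝ)) * (1 - 1 / (n : ℝ)) ^ (n - 1) := by
  unfold pR
  rw [← Finset.mul_prod_erase Finset.univ _ (Finset.mem_univ i)]
  congr 1
  · simp only [eC, Function.update_self]; split_ifs
    · exact kR_dn _ _
    · exact kR_up _ _
  · rw [Finset.prod_congr rfl (g := fun _ => 1 - 1 / (n : ℝ))]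
    · simp
    · intro j hj
      have hj := Finset.ne_of_mem_erase hj
      simp only [eC, Function.update_of_ne hj]; exact kR_zero _ _

lemma flip_t {n : ℕ} (a x : Fin n → ℤ) (i : Fin n) (hi : x i ≠ a i) {y : Fin n → ℤ}
    (hy : y ∈ boxF x) : tZ (a i) (x i) (flipC x i y i) = - tZ (a i) (x i) (y i) := by
  have := mem_boxF.1 hy i
  simp only [flipC, Function.update_self, tZ]
  omega

lemma flip_t_sum {n : ℕ} (a x : Fin n → ℤ) (i : Fin n) (hi : x i ≠ a i) {y : Fin n → ℤ}
    (hy : y ∈ boxF x) : ∑ j, tZ (a j) (x j) (flipC x i y j) =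
      ∑ j, tZ (a j) (x j) (y j) - 2 * tZ (a i) (x i) (y i) := by
  rw [← Finset.add_sum_erase Finset.univ _ (Finset.mem_univ i),
    ← Finset.add_sum_erase Finset.univ (fun j => tZ (a j) (x j) (y j)) (Finset.mem_univ i),
    flip_t a x i hi hy]
  have : ∑ j ∈ Finset.univ.erase i, tZ (a j) (x j) (flipC x i y j) =
      ∑ j ∈ Finset.univ.erase i, tZ (a j) (x j) (y j) := by
    apply Finset.sum_congr rfl
    intro j hj
    simp [flipC, Finset.ne_of_mem_erase hj]
  rw [this]; ring

lemma t_cases {n : ℕ} (a x : Fin n → ℤ) (i : Fin n) {y : Fin n → ℤ}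
    (hy : y ∈ boxF x) : tZ (a i) (x i) (y i) = -1 ∨ tZ (a i) (x i) (y i) = 0 ∨
      tZ (a i) (x i) (y i) = 1 := by
  have := mem_boxF.1 hy i
  simp only [tZ]; omega

/-- claim 1 -/
lemma claim1 {n : ℕ} (hn : 0 < n) (a x : Fin n → ℤ) (i : Fin n) (hi : x i ≠ a i) :
    1 / (2 * (n : ℝ)) * (1 - 1 / (n : ℝ)) ^ (n - 1) ≤
      ∑ y ∈ boxF x, pR x y * (accR a x y * (tZ (a i) (x i) (y i) : ℝ)) := by
  have e : ∑ y ∈ boxF x, pR x y * (accR a x y * (tZ (a i) (x i) (y i) : ℝ)) =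
      ∑ y ∈ boxF x, pR x y * ((accR a x y - accR a x (flipC x i y)) *
        (if tZ (a i) (x i) (y i) = 1 then 1 else 0)) := by
    have h1 : ∀ y ∈ boxF x, pR x y * (accR a x y * (tZ (a i) (x i) (y i) : ℝ)) =
      pR x y * (accR a x y * (if tZ (a i) (x i) (y i) = 1 then 1 else 0)) -
      pR x y * (accR a x y * (if tZ (a i) (x i) (y i) = -1 then 1 else 0)) := by
      intro y hy
      rcases t_cases a x i hy with h | h | h <;> simp [h]
    rw [Finset.sum_congr rfl h1, Finset.sum_sub_distrib,
      ← sum_flip x i (fun y => pR x y * (accR a x y * (if tZ (a i) (x i) (y i) = -1 then 1 else 0))),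
      ← Finset.sum_sub_distrib]
    apply Finset.sum_congr rfl
    intro y hy
    rw [pR_flip, flip_t a x i hi hy]
    simp only [neg_inj]; ring
  rw [e, ← pR_eC a x i]
  have hs := Finset.single_le_sum (f := fun y => pR x y * ((accR a x y - accR a x (flipC x i y)) *
        (if tZ (a i) (x i) (y i) = 1 then 1 else 0))) (s := boxF x) ?_ (eC_mem a x i)
  · refine le_trans (le_of_eq ?_) hs
    have h1 : accR a x (eC a x i) = 1 := by
      simp [accR, acc_iff, eC_sum a x i hi]
    have h2 : accR a x (flipC x i (eC a x i)) = 0 := by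
      simp [accR, acc_iff, flip_t_sum a x i hi (eC_mem a x i), eC_sum a x i hi, eC_t a x i hi]
    simp [h1, h2, eC_t a x i hi]
  · intro y hy
    apply mul_nonneg (pR_nonneg hn _ _)
    split_ifs with h
    · unfold accR
      simp only [acc_iff, flip_t_sum a x i hi hy, h]
      split_ifs <;> first | omega | norm_num
    · simp

lemma claim2 {n : ℕ} (hn : 0 < n) (a x : Fin n → ℤ) :
    ∑ i ∈ Finset.univ.filter (fun i => x i ≠ a i),
      1 / (2 * (n : ℝ)) * (1 - 1 / (n : ℝ)) ^ (n - 1) ≤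
      ∑ y ∈ boxF x, pR x y * (accR a x y * ∑ i, (tZ (a i) (x i) (y i) : ℝ)) := by
  have h1 : ∀ y, accR a x y * ∑ i, (tZ (a i) (x i) (y i) : ℝ) =
      if 0 ≤ ∑ i, tZ (a i) (x i) (y i) then ((∑ i, tZ (a i) (x i) (y i) : ℤ) : ℝ) else 0 := by
    intro y; simp [accR, acc_iff]
  simp only [h1]
  have h2 : ∑ y ∈ (Finset.univ.filter (fun i => x i ≠ a i)).image (eC a x), pR x y *
      (if 0 ≤ ∑ i, tZ (a i) (x i) (y i) then ((∑ i, tZ (a i) (x i) (y i) : ℤ) : ℝ) else 0) =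
      ∑ i ∈ Finset.univ.filter (fun i => x i ≠ a i),
      1 / (2 * (n : ℝ)) * (1 - 1 / (n : ℝ)) ^ (n - 1) := by
    rw [Finset.sum_image (fun i _ j _ h => eC_inj a x h)]
    apply Finset.sum_congr rfl
    intro i hi
    rw [eC_sum a x i (Finset.mem_filter.1 hi).2, pR_eC]; simp
  rw [← h2]
  apply Finset.sum_le_sum_of_subset_of_nonneg
  · intro y hy
    obtain ⟨i, _, rfl⟩ := Finset.mem_image.1 hy
    exact eC_mem a x i
  · intro y _ _
    apply mul_nonneg (pR_nonneg hn _ _)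
    split_ifs with h
    · exact_mod_cast h
    · exact le_rfl

lemma claim3 {n : ℕ} (hn : 0 < n) (a x : Fin n → ℤ) (i : Fin n) (hi : x i ≠ a i) :
    ∑ y ∈ boxF x, pR x y * (accR a x y * (if tZ (a i) (x i) (y i) = -1 then 1 else 0)) ≤
      1 / (2 * (n : ℝ)) := by
  have h : ∑ y ∈ boxF x, pR x y * (accR a x y * (if tZ (a i) (x i) (y i) = -1 then 1 else 0)) ≤
      ∑ y ∈ boxF x, pR x y * (if tZ (a i) (x i) (y i) = -1 then 1 else 0) := by
    apply Finset.sum_le_sum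
    intro y _
    apply mul_le_mul_of_nonneg_left _ (pR_nonneg hn _ _)
    unfold accR
    split_ifs <;> norm_num
  refine h.trans (le_of_eq ?_)
  rw [pR_marg x i (fun z => if tZ (a i) (x i) z = -1 then 1 else 0), sum_three, kR_zero, kR_up,
    kR_dn]
  have h0 : ¬ tZ (a i) (x i) (x i) = -1 := by simp [tZ]
  rcases lt_or_gt_of_ne hi with hi | hi
  · have h1 : tZ (a i) (x i) (x i - 1) = -1 := by simp only [tZ]; omega
    have h2 : ¬ tZ (a i) (x i) (x i + 1) = -1 := by simp only [tZ]; omega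
    simp [h0, h1, h2]
  · have h1 : ¬ tZ (a i) (x i) (x i - 1) = -1 := by simp only [tZ]; omega
    have h2 : tZ (a i) (x i) (x i + 1) = -1 := by simp only [tZ]; omega
    simp [h0, h1, h2]

lemma exp_bound {n : ℕ} (hn : 0 < n) :
    1 / Real.exp 1 ≤ (1 - 1 / (n : ℝ)) ^ (n - 1) := by
  obtain ⟨m, rfl⟩ : ∃ m, n = m + 1 := ⟨n - 1, by omega⟩
  simp only [Nat.add_sub_cancel]
  rcases Nat.eq_zero_or_pos m with rfl | hm
  · simp only [pow_zero]
    rw [div_le_one (Real.exp_pos 1)]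
    exact Real.one_le_exp zero_le_one
  have hm' : (0 : ℝ) < m := by exact_mod_cast hm
  have e : (1 - 1 / ((m + 1 : ℕ) : ℝ)) = (1 + 1 / (m : ℝ))⁻¹ := by
    push_cast; field_simp; ring
  rw [e, inv_pow, one_div]
  apply inv_anti₀ (by positivity)
  calc (1 + 1 / (m : ℝ)) ^ m ≤ (Real.exp (1 / m)) ^ m := by
        apply pow_le_pow_left₀ (by positivity)
        have := Real.add_one_le_exp (1 / (m : ℝ)); linarith
    _ = Real.exp 1 := by
        rw [← Real.exp_nat_mul]; congr 1; field_simp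

lemma pot_step (ω : ℝ) (α ξ z : ℤ) (hz : z = ξ - 1 ∨ z = ξ ∨ z = ξ + 1) :
    ω ^ (α - ξ).natAbs - ω ^ (α - z).natAbs =
      (ω - 1) * ((ω ^ ((α - ξ).natAbs - 1) - 1) * (tZ α ξ z : ℝ) + (tZ α ξ z : ℝ) -
        (ω - 1) * ((if ξ ≠ α then ω ^ ((α - ξ).natAbs - 1) else 0) *
          (if tZ α ξ z = -1 then 1 else 0))) := by
  obtain ⟨d, hd⟩ : ∃ d, d = (α - ξ).natAbs := ⟨_, rfl⟩
  obtain ⟨d', hd'⟩ : ∃ d, d = (α - z).natAbs := ⟨_, rfl⟩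
  have ht : tZ α ξ z = (d : ℤ) - d' := by simp only [tZ]; omega
  rw [ht, ← hd, ← hd']
  have hne : ξ ≠ α ↔ d ≠ 0 := by omega
  simp only [hne]
  rcases Nat.eq_zero_or_pos d with h0 | h0
  · have : d' = 0 ∨ d' = 1 := by omega
    rcases this with h | h <;> subst h <;> subst h0 <;> simp
  · obtain ⟨k, rfl⟩ : ∃ k, d = k + 1 := ⟨d - 1, by omega⟩
    have : d' = k ∨ d' = k + 1 ∨ d' = k + 2 := by omega
    rcases this with h | h | h
    · subst h; simp; ring
    · subst h; simp
    · subst h; simp; ring_nf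

lemma drift_real_s6 {n : ℕ} (hn : 0 < n) (a : Fin n → ℤ)
    (ω : ℝ) (hω : 1 < ω)
    (hcond : 0 < ω - 1 - Real.exp 1 * (ω - 1) ^ 2)
    (c : ℝ) (hc : c = (ω - 1 - Real.exp 1 * (ω - 1) ^ 2) / Real.exp 1)
    (g : (Fin n → ℤ) → ℝ)
    (hg : ∀ y, g y = ∑ i, (ω ^ (a i - y i).natAbs - 1))
    (x : Fin n → ℤ) :
    c / (2 * ω * n) * g x ≤ ∑ y ∈ boxF x, pR x y * (accR a x y * (g x - g y)) := by
  have hn' : (0 : ℝ) < n := by exact_mod_cast hn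
  set q : ℝ := 1 / (2 * (n : ℝ)) * (1 - 1 / (n : ℝ)) ^ (n - 1) with hq
  set w : Fin n → ℝ := fun i => ω ^ ((a i - x i).natAbs - 1) with hw
  set T : Fin n → ℝ := fun i =>
    ∑ y ∈ boxF x, pR x y * (accR a x y * (tZ (a i) (x i) (y i) : ℝ)) with hT
  set L : Fin n → ℝ := fun i =>
    ∑ y ∈ boxF x, pR x y * (accR a x y * (if tZ (a i) (x i) (y i) = -1 then 1 else 0)) with hL
  have hw1 : ∀ i, 1 ≤ w i := fun i => one_le_pow₀ hω.le
  have e : ∑ y ∈ boxF x, pR x y * (accR a x y * (g x - g y)) =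
      (ω - 1) * (∑ i, (w i - 1) * T i +
        ∑ y ∈ boxF x, pR x y * (accR a x y * ∑ i, (tZ (a i) (x i) (y i) : ℝ)) -
        (ω - 1) * ∑ i, (if x i ≠ a i then w i else 0) * L i) := by
    have e1 : ∀ y ∈ boxF x, pR x y * (accR a x y * (g x - g y)) =
        (ω - 1) * (∑ i, (w i - 1) * (pR x y * (accR a x y * (tZ (a i) (x i) (y i) : ℝ))) +
          pR x y * (accR a x y * ∑ i, (tZ (a i) (x i) (y i) : ℝ)) -
        (ω - 1) * ∑ i, (if x i ≠ a i then w i else 0) * (pR x y * (accR a x y *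
          (if tZ (a i) (x i) (y i) = -1 then 1 else 0)))) := by
      intro y hy
      rw [hg, hg, ← Finset.sum_sub_distrib]
      simp only [Finset.mul_sum]
      rw [← Finset.sum_add_distrib, ← Finset.sum_sub_distrib, Finset.mul_sum]
      apply Finset.sum_congr rfl
      intro i _
      have := pot_step ω (a i) (x i) (y i) (mem_boxF.1 hy i)
      rw [sub_sub_sub_cancel_right, this]
      ring
    rw [Finset.sum_congr rfl e1, ← Finset.mul_sum, Finset.sum_sub_distrib,
      Finset.sum_add_distrib, ← Finset.mul_sum, Finset.sum_comm, 
      Finset.sum_comm (f := fun y i => (if x i ≠ a i then w i else 0) * (pR x y * (accR a x y *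
          (if tZ (a i) (x i) (y i) = -1 then 1 else 0))))]
    simp only [hT, hL, Finset.mul_sum]
  rw [e]
  have b2 := claim2 hn a x
  rw [← hq] at b2
  rw [Finset.sum_filter] at b2
  have b1 : ∑ i, (if x i ≠ a i then (w i - 1) * q else 0) ≤ ∑ i, (w i - 1) * T i := by
    apply Finset.sum_le_sum
    intro i _
    split_ifs with h
    · exact mul_le_mul_of_nonneg_left (claim1 hn a x i h) (by linarith [hw1 i])
    · push Not at h
      simp [hw, h]
  have b3 : ∑ i, (if x i ≠ a i then w i else 0) * L i ≤
      ∑ i, (if x i ≠ a i then w i * (1 / (2 * (n : ℝ))) else 0) := by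
    apply Finset.sum_le_sum
    intro i _
    split_ifs with h
    · exact mul_le_mul_of_nonneg_left (claim3 hn a x i h) (by linarith [hw1 i])
    · simp
  have hq1 : 1 / (2 * (n : ℝ)) * (1 / Real.exp 1) ≤ q :=
    mul_le_mul_of_nonneg_left (exp_bound hn) (by positivity)
  have hE := Real.exp_pos 1
  have hcpos : 0 < c := by rw [hc]; positivity
  have key : c / (2 * ω * n) * g x ≤ (ω - 1) *
      (∑ i, (if x i ≠ a i then (w i - 1) * q else 0) + ∑ i, (if x i ≠ a i then q else 0) -
        (ω - 1) * ∑ i, (if x i ≠ a i then w i * (1 / (2 * (n : ℝ))) else 0)) := by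
    rw [hg, Finset.mul_sum, Finset.mul_sum, ← Finset.sum_add_distrib, ← Finset.sum_sub_distrib,
      Finset.mul_sum]
    apply Finset.sum_le_sum
    intro i _
    split_ifs with h
    · have hpw : ω ^ (a i - x i).natAbs = ω * w i := by
        simp only [hw]
        rw [← pow_succ']; congr 1; omega
      have s1 : c / (2 * ω * n) * (ω ^ (a i - x i).natAbs - 1) ≤ c / (2 * ω * n) * (ω * w i) := by
        apply mul_le_mul_of_nonneg_left _ (by positivity)
        rw [hpw]; linarith
      have s2 : c / (2 * ω * n) * (ω * w i) = (ω - 1) *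
          (w i * (1 / (2 * (n : ℝ)) * (1 / Real.exp 1)) - (ω - 1) * (w i * (1 / (2 * (n : ℝ))))) := by
        rw [hc]; field_simp
      rw [s2] at s1
      refine s1.trans (mul_le_mul_of_nonneg_left ?_ (by linarith))
      have := mul_le_mul_of_nonneg_left hq1 (by linarith [hw1 i] : 0 ≤ w i)
      linarith
    · push Not at h
      simp [h]
  refine key.trans (mul_le_mul_of_nonneg_left ?_ (by linarith))
  have := mul_le_mul_of_nonneg_left b3 (by linarith : 0 ≤ ω - 1)
  linarith

lemma trans_sum {n : ℕ} (hn : 0 < n) (a x : Fin n → ℤ) (g : (Fin n → ℤ) → ℝ)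
    (hg0 : ∀ y, 0 ≤ g y) :
    (∑' y : Fin n → ℤ, transP n a pmStepP x y * ENNReal.ofReal (g y)).toReal =
      ∑ y ∈ boxF x, pR x y * (accR a x y * g y) +
      (∑ y ∈ boxF x, pR x y * (1 - accR a x y)) * g x := by
  have hA : ∀ y, 0 ≤ pR x y * (accR a x y * g y) := fun y =>
    mul_nonneg (pR_nonneg hn _ _) (mul_nonneg (by unfold accR; split_ifs <;> norm_num) (hg0 y))
  have hB : ∀ y, 0 ≤ pR x y * (1 - accR a x y) := fun y =>
    mul_nonneg (pR_nonneg hn _ _) (by unfold accR; split_ifs <;> norm_num)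
  have hr : (∑' z : Fin n → ℤ, (if fitness a x < fitness a z then mutP n pmStepP x z else 0)) =
      ENNReal.ofReal (∑ y ∈ boxF x, pR x y * (1 - accR a x y)) := by
    rw [ENNReal.ofReal_sum_of_nonneg fun y _ => hB y]
    rw [tsum_eq_sum (s := boxF x)]
    · apply Finset.sum_congr rfl
      intro y _
      unfold accR
      rw [mutP_eq hn]
      by_cases h : fitness a y ≤ fitness a x
      · simp [h]
      · simp [h, not_le.1 h]
    · intro y hy
      rw [mutP_eq hn, pR_eq_zero hy]; simp
  have hm : (∑' y : Fin n → ℤ, transP n a pmStepP x y * ENNReal.ofReal (g y)) =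
      ENNReal.ofReal (∑ y ∈ boxF x, pR x y * (accR a x y * g y)) +
      ENNReal.ofReal (∑ y ∈ boxF x, pR x y * (1 - accR a x y)) * ENNReal.ofReal (g x) := by
    unfold transP
    rw [hr]
    simp only [add_mul]
    rw [ENNReal.tsum_add]
    congr 1
    · rw [ENNReal.ofReal_sum_of_nonneg fun y _ => hA y]
      rw [tsum_eq_sum (s := boxF x)]
      · apply Finset.sum_congr rfl
        intro y _
        unfold accR
        rw [mutP_eq hn]
        split_ifs
        · rw [one_mul, ENNReal.ofReal_mul (pR_nonneg hn _ _)]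
        · simp
      · intro y hy
        rw [mutP_eq hn, pR_eq_zero hy]; simp
    · rw [tsum_eq_single x]
      · simp
      · intro y hy; simp [hy]
  rw [hm, ENNReal.toReal_add (by simp) (ENNReal.mul_ne_top (by simp) (by simp)),
    ENNReal.toReal_mul, ENNReal.toReal_ofReal (Finset.sum_nonneg fun y _ => hA y),
    ENNReal.toReal_ofReal (Finset.sum_nonneg fun y _ => hB y), ENNReal.toReal_ofReal (hg0 x)]

/-- **Drift of the exponential potential for the (1+1) EA with the ±1 operator.**
Fix `ω > 1` with `ω − 1 − e(ω−1)² > 0` and set `c = (ω − 1 − e(ω−1)²)/e`.  For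
`a ∈ ℤⁿ \ {0ⁿ}` consider the potential `g(x) = ∑ i, (ω^{d_i} − 1)` with `d_i = |a_i − x_i|`.
If `x` is the current search point of the (1+1) EA with the `±1` operator on `f_a` and
`g(x) > 0`, and `Y` is the search point after one iteration of mutation and selection, then
`E[g(x) − g(Y)] ≥ (c/(2ωn)) · g(x)`.  (Since `g ≥ 0`, the expectation `E[g(Y)]` is written
as `(∑'_y P(Y = y) · g(y)).toReal`.) -/
theorem ea_pm_potential_drift
    (n : ℕ) (a : Fin n → ℤ) (ha : a ≠ 0)
    (ω : ℝ) (hω : 1 < ω)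
    (hcond : 0 < ω - 1 - Real.exp 1 * (ω - 1) ^ 2)
    (c : ℝ) (hc : c = (ω - 1 - Real.exp 1 * (ω - 1) ^ 2) / Real.exp 1)
    (g : (Fin n → ℤ) → ℝ)
    (hg : ∀ y, g y = ∑ i, (ω ^ (a i - y i).natAbs - 1))
    (x : Fin n → ℤ) (hx : 0 < g x) :
    c / (2 * ω * n) * g x ≤
      g x - (∑' y : Fin n → ℤ, transP n a pmStepP x y * ENNReal.ofReal (g y)).toReal := by
  have hn : 0 < n := by
    rcases Nat.eq_zero_or_pos n with h | h
    · subst h; exact absurd (Subsingleton.elim a 0) ha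
    · exact h
  have hg0 : ∀ y, 0 ≤ g y := by
    intro y; rw [hg]
    apply Finset.sum_nonneg
    intro i _
    have : 1 ≤ ω ^ (a i - y i).natAbs := one_le_pow₀ hω.le
    linarith
  rw [trans_sum hn a x g hg0]
  refine (drift_real_s6 hn a ω hω hcond c hc g hg x).trans (le_of_eq ?_)
  have e : g x = (∑ y ∈ boxF x, pR x y) * g x := by rw [pR_sum, one_mul]
  conv_rhs => lhs; rw [e]
  rw [Finset.sum_mul, Finset.sum_mul, ← Finset.sum_add_distrib, ← Finset.sum_sub_distrib]
  apply Finset.sum_congr rfl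
  intro y _
  ring
end

section
/- Lower bound for the (1+1) EA with the ±1 operator: For every a ∈ ℤⁿ \ {0ⁿ}, the expected optimization time of the (1+1) EA with the ±1 step operator, started at the all-0 integer string, on the fitness function f_a is Ω(|a|_∞ · n + n · log |a|_H). -/
open scoped ENNReal BigOperators

lemma inv_add_compl {n : ℕ} (hn : 0 < n) :
    (1 - 1 / (n : ℝ≥0∞)) + 1 / (n : ℝ≥0∞) = 1 := by
  apply tsub_add_cancel_of_le
  rw [one_div]
  exact ENNReal.inv_le_one.2 (by exact_mod_cast hn)

lemma coordMutP_eq_zero (n : ℕ) (x z : ℤ) (hz : z ∉ ({x - 1, x, x + 1} : Finset ℤ)) :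
    coordMutP n pmStepP x z = 0 := by
  simp only [Finset.mem_insert, Finset.mem_singleton, not_or] at hz
  simp [coordMutP, pmStepP, hz.1, hz.2.1, hz.2.2]

lemma coord_sum (n : ℕ) (x : ℤ) (w : ℤ → ℝ≥0∞) (b c : ℝ≥0∞) (h0 : w x = b)
    (h1 : ∀ z, z ≠ x → w z = c) :
    ∑ z ∈ ({x - 1, x, x + 1} : Finset ℤ), coordMutP n pmStepP x z * w z
      = (1 - 1 / (n : ℝ≥0∞)) * b + 1 / (n : ℝ≥0∞) * c := by
  rw [Finset.sum_insert (by simp; omega), Finset.sum_insert (by simp), Finset.sum_singleton, h0,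
    h1 (x - 1) (by omega), h1 (x + 1) (by omega)]
  have e1 : x - 1 ≠ x := by omega
  have e2 : x - 1 ≠ x + 1 := by omega
  have e3 : x ≠ x + 1 := by omega
  have e4 : x ≠ x - 1 := by omega
  have e5 : x + 1 ≠ x := by omega
  have e6 : x + 1 ≠ x - 1 := by omega
  simp only [coordMutP, pmStepP, e1, e2, e3, e4, e5, e6, if_true, if_false, mul_zero, mul_one,
    zero_add, add_zero]
  have hh : (1 / 2 : ℝ≥0∞) + 1 / 2 = 1 := ENNReal.add_halves 1
  calc _ = (1 - 1 / (n : ℝ≥0∞)) * b + 1 / (n : ℝ≥0∞) * ((1 / 2 : ℝ≥0∞) + 1 / 2) * c := by ring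
    _ = _ := by rw [hh, mul_one]

lemma mut_sum (n : ℕ) (x : Fin n → ℤ) (w : Fin n → ℤ → ℝ≥0∞) (b c : Fin n → ℝ≥0∞)
    (h0 : ∀ i, w i (x i) = b i) (h1 : ∀ i z, z ≠ x i → w i z = c i) :
    ∑' z : Fin n → ℤ, mutP n pmStepP x z * ∏ i, w i (z i)
      = ∏ i, ((1 - 1 / (n : ℝ≥0∞)) * b i + 1 / (n : ℝ≥0∞) * c i) := by
  rw [tsum_eq_sum (s := Fintype.piFinset fun i => ({x i - 1, x i, x i + 1} : Finset ℤ))]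
  · have : ∀ i, (1 - 1 / (n : ℝ≥0∞)) * b i + 1 / (n : ℝ≥0∞) * c i =
        ∑ z ∈ ({x i - 1, x i, x i + 1} : Finset ℤ), coordMutP n pmStepP (x i) z * w i z :=
      fun i => (coord_sum n (x i) (w i) (b i) (c i) (h0 i) (h1 i)).symm
    simp_rw [this]
    rw [Finset.prod_univ_sum]
    refine Finset.sum_congr rfl fun z _ => ?_
    rw [mutP, Finset.prod_mul_distrib]
  · intro z hz
    rw [Fintype.mem_piFinset] at hz
    push Not at hz
    obtain ⟨i, hi⟩ := hz
    rw [mutP, Finset.prod_eq_zero (Finset.mem_univ i) (coordMutP_eq_zero n _ _ hi), zero_mul]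

lemma mut_sum_one {n : ℕ} (hn : 0 < n) (x : Fin n → ℤ) :
    ∑' z : Fin n → ℤ, mutP n pmStepP x z = 1 := by
  have := mut_sum n x (fun _ _ => 1) (fun _ => 1) (fun _ => 1) (by simp) (by simp)
  simpa [-one_div, inv_add_compl hn] using this

lemma mut_sum_ne {n : ℕ} (hn : 0 < n) (x : Fin n → ℤ) (i : Fin n) :
    ∑' z : Fin n → ℤ, mutP n pmStepP x z * (if z i = x i then 0 else 1) = 1 / (n : ℝ≥0∞) := by
  have := mut_sum n x (fun j z => if j = i then (if z = x j then 0 else 1) else 1)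
    (fun j => if j = i then 0 else 1) (fun _ => 1) (by intro j; simp)
    (by intro j z hz; simp [hz])
  have e : ∀ j, (1 - 1 / (n : ℝ≥0∞)) * (if j = i then 0 else 1) + 1 / (n : ℝ≥0∞) * 1
      = if j = i then 1 / (n : ℝ≥0∞) else 1 := by
    intro j
    split_ifs
    · simp
    · rw [mul_one, mul_one, inv_add_compl hn]
  simp_rw [e, Finset.prod_ite_eq' Finset.univ i] at this
  simpa using this

lemma trans_sum_s7 (n : ℕ) (a x : Fin n → ℤ) (φ : (Fin n → ℤ) → ℝ≥0∞) :
    ∑' y, transP n a pmStepP x y * φ y =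
      ∑' z, mutP n pmStepP x z * (if fitness a z ≤ fitness a x then φ z else φ x) := by
  simp only [transP, add_mul]
  rw [ENNReal.tsum_add]
  have h2 : ∑' y, (if y = x then ∑' z : Fin n → ℤ,
      (if fitness a x < fitness a z then mutP n pmStepP x z else 0) else 0) * φ y
      = ∑' z : Fin n → ℤ,
      (if fitness a x < fitness a z then mutP n pmStepP x z else 0) * φ x := by
    rw [tsum_eq_single x (by intro y hy; simp [hy]), if_pos rfl, ENNReal.tsum_mul_right]
  rw [h2, ← ENNReal.tsum_add]
  refine tsum_congr fun z => ?_
  by_cases h : fitness a z ≤ fitness a x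
  · simp [h, not_lt.2 h]
  · simp [h, not_le.1 h]

lemma dist_step (n : ℕ) (a : Fin n → ℤ) (t : ℕ) (φ : (Fin n → ℤ) → ℝ≥0∞) :
    ∑' y, eaDist n a pmStepP (t + 1) y * φ y =
      ∑' x, eaDist n a pmStepP t x *
        ∑' z, mutP n pmStepP x z * (if fitness a z ≤ fitness a x then φ z else φ x) := by
  simp_rw [← trans_sum_s7, eaDist, ← ENNReal.tsum_mul_right, ← ENNReal.tsum_mul_left]
  rw [ENNReal.tsum_comm]
  simp_rw [mul_assoc]

lemma eaDist_start (n : ℕ) (a : Fin n → ℤ) (φ : (Fin n → ℤ) → ℝ≥0∞) :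
    ∑' y, eaDist n a pmStepP 0 y * φ y = φ (fun _ => 0) := by
  rw [tsum_eq_single (fun _ => 0) (by intro y hy; simp [eaDist, hy])]
  simp [eaDist]

lemma dist_mass {n : ℕ} (hn : 0 < n) (a : Fin n → ℤ) (t : ℕ) :
    ∑' y, eaDist n a pmStepP t y = 1 := by
  induction t with
  | zero => simpa using eaDist_start n a (fun _ => 1)
  | succ t ih =>
    have := dist_step n a t (fun _ => 1)
    simpa [mut_sum_one hn, ih] using this

/-- probability of being optimal at time `t` -/
noncomputable def optP (n : ℕ) (a : Fin n → ℤ) (t : ℕ) : ℝ≥0∞ :=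
  ∑' x, eaDist n a pmStepP t x * (if fitness a x = 0 then 1 else 0)

lemma fitness_zero {n : ℕ} {a x : Fin n → ℤ} (h : fitness a x = 0) : x = a := by
  funext i
  have := (Finset.sum_eq_zero_iff.1 h) i (Finset.mem_univ i)
  omega

lemma time_lower {n : ℕ} (hn : 0 < n) (a : Fin n → ℤ) (τ : ℝ)
    (h : ∀ t : ℕ, (t : ℝ) ≤ τ → optP n a t ≤ 1 / 2) :
    ENNReal.ofReal (τ / 2) ≤ eaExpTime n a pmStepP := by
  rcases le_or_gt τ 0 with hτ | hτ
  · rw [ENNReal.ofReal_of_nonpos (by linarith)]; exact zero_le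
  have key : ∀ t ∈ Finset.range (⌊τ⌋₊ + 1), (1 / 2 : ℝ≥0∞) ≤
      ∑' x : Fin n → ℤ, if fitness a x = 0 then 0 else eaDist n a pmStepP t x := by
    intro t ht
    have ht' : (t : ℝ) ≤ τ := by
      rw [Finset.mem_range, Nat.lt_succ_iff] at ht
      exact (Nat.le_floor_iff hτ.le).1 ht
    have h1 := h t ht'
    have h2 : optP n a t + (∑' x : Fin n → ℤ,
        if fitness a x = 0 then 0 else eaDist n a pmStepP t x) = 1 := by
      rw [optP, ← ENNReal.tsum_add]
      refine Eq.trans ?_ (dist_mass hn a t)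
      refine tsum_congr fun x => ?_
      split_ifs <;> simp
    have h3 : (1 / 2 : ℝ≥0∞) + 1 / 2 = 1 := ENNReal.add_halves 1
    by_contra hc
    push Not at hc
    have : optP n a t + (∑' x : Fin n → ℤ,
        if fitness a x = 0 then 0 else eaDist n a pmStepP t x) < 1 / 2 + 1 / 2 :=
      ENNReal.add_lt_add_of_le_of_lt (ne_top_of_le_ne_top (by simp) h1) h1 hc
    rw [h2, h3] at this
    exact lt_irrefl _ this
  calc ENNReal.ofReal (τ / 2) ≤ ENNReal.ofReal (((⌊τ⌋₊ + 1 : ℕ) : ℝ) * (1 / 2)) := by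
        apply ENNReal.ofReal_le_ofReal
        have := (Nat.lt_floor_add_one τ).le
        push_cast
        linarith
    _ = ∑ t ∈ Finset.range (⌊τ⌋₊ + 1), (1 / 2 : ℝ≥0∞) := by
        rw [Finset.sum_const, Finset.card_range, nsmul_eq_mul, ENNReal.ofReal_mul (by positivity),
          ENNReal.ofReal_natCast, ENNReal.ofReal_div_of_pos (by norm_num)]
        simp
    _ ≤ _ := (Finset.sum_le_sum key).trans (ENNReal.sum_le_tsum _)

/-- progress towards `a i` -/
def prog {n : ℕ} (a : Fin n → ℤ) (i : Fin n) (x : Fin n → ℤ) : ℕ :=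
  (a i).natAbs - (x i - a i).natAbs

/-- like `mutP` support: a mutated coordinate changes by at most one -/
lemma mut_support {n : ℕ} (x z : Fin n → ℤ) (h : mutP n pmStepP x z ≠ 0) (i : Fin n) :
    z i = x i - 1 ∨ z i = x i ∨ z i = x i + 1 := by
  by_contra hc
  apply h
  rw [mutP]
  refine Finset.prod_eq_zero (Finset.mem_univ i) (coordMutP_eq_zero n _ _ ?_)
  simpa using hc

lemma prog_bound {n : ℕ} (hn : 0 < n) (a : Fin n → ℤ) (i : Fin n) (t : ℕ) :
    ∑' x, eaDist n a pmStepP t x * (prog a i x : ℝ≥0∞) ≤ t * (1 / (n : ℝ≥0∞)) := by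
  induction t with
  | zero => rw [eaDist_start]; simp [prog]
  | succ t ih =>
    rw [dist_step]
    have hx : ∀ x : Fin n → ℤ, ∑' z, mutP n pmStepP x z *
        (if fitness a z ≤ fitness a x then (prog a i z : ℝ≥0∞) else (prog a i x : ℝ≥0∞))
        ≤ prog a i x + 1 / (n : ℝ≥0∞) := by
      intro x
      calc _ ≤ ∑' z, (mutP n pmStepP x z * (prog a i x : ℝ≥0∞) +
            mutP n pmStepP x z * (if z i = x i then 0 else 1)) := by
            refine ENNReal.tsum_le_tsum fun z => ?_
            rw [← mul_add]
            by_cases hm : mutP n pmStepP x z = 0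
            · simp [hm]
            gcongr
            split_ifs with h1 h2 h2
            · simp [prog, h2]
            · have := mut_support x z hm i
              have h3 : prog a i z ≤ prog a i x + 1 := by
                unfold prog
                omega
              exact_mod_cast h3
            · simp
            · exact le_self_add
        _ = _ := by
            rw [ENNReal.tsum_add, ENNReal.tsum_mul_right, mut_sum_one hn, mut_sum_ne hn, one_mul]
    calc _ ≤ ∑' x, eaDist n a pmStepP t x * (prog a i x + 1 / (n : ℝ≥0∞)) := by
          refine ENNReal.tsum_le_tsum fun x => ?_
          gcongr
          exact hx x
      _ = (∑' x, eaDist n a pmStepP t x * (prog a i x : ℝ≥0∞)) + 1 / (n : ℝ≥0∞) := by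
          simp_rw [mul_add]
          rw [ENNReal.tsum_add, ENNReal.tsum_mul_right, dist_mass hn, one_mul]
      _ ≤ _ := by
          push_cast
          rw [add_mul, one_mul]
          gcongr

lemma part_one {n : ℕ} (hn : 0 < n) (a : Fin n → ℤ) (i : Fin n) :
    ENNReal.ofReal (((a i).natAbs : ℝ) * n / 2 / 2) ≤ eaExpTime n a pmStepP := by
  rcases Nat.eq_zero_or_pos (a i).natAbs with h0 | hm
  · simp [h0]
  apply time_lower hn
  intro t ht
  have hn0 : (n : ℝ≥0∞) ≠ 0 := by exact_mod_cast hn.ne'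
  have hm0 : ((a i).natAbs : ℝ≥0∞) ≠ 0 := by exact_mod_cast hm.ne'
  have h1 : optP n a t * (a i).natAbs ≤ t * (1 / (n : ℝ≥0∞)) := by
    refine le_trans ?_ (prog_bound hn a i t)
    rw [optP, ← ENNReal.tsum_mul_right]
    refine ENNReal.tsum_le_tsum fun x => ?_
    rw [mul_assoc]
    gcongr
    split_ifs with h
    · rw [fitness_zero h]; simp [prog]
    · simp
  have h2 : optP n a t ≤ t * (1 / (n : ℝ≥0∞)) / (a i).natAbs :=
    (ENNReal.le_div_iff_mul_le (Or.inl hm0) (Or.inl (by simp))).2 h1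
  refine h2.trans ?_
  have h3 : t * 2 ≤ (a i).natAbs * n := by
    have : (t : ℝ) * 2 ≤ (a i).natAbs * n := by linarith
    exact_mod_cast this
  rw [ENNReal.div_le_iff hm0 (by simp), mul_one_div, ENNReal.div_le_iff hn0 (by simp), mul_assoc,
    mul_comm (1 / 2 : ℝ≥0∞), mul_one_div, ENNReal.le_div_iff_mul_le (by simp) (by simp)]
  exact_mod_cast h3

/-- `pSeq n t = 1 - (1 - 1/n)^t`, by recursion -/
noncomputable def pSeq (n : ℕ) : ℕ → ℝ≥0∞
  | 0 => 0
  | t + 1 => (1 - 1 / (n : ℝ≥0∞)) * pSeq n t + 1 / (n : ℝ≥0∞)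

lemma pSeq_le_one {n : ℕ} (hn : 0 < n) (t : ℕ) : pSeq n t ≤ 1 := by
  induction t with
  | zero => simp [pSeq]
  | succ t ih =>
    rw [pSeq]
    calc _ ≤ (1 - 1 / (n : ℝ≥0∞)) * 1 + 1 / (n : ℝ≥0∞) := by gcongr
      _ = 1 := by rw [mul_one, inv_add_compl hn]

/-- product form of `p ^ (number of wrong coordinates)` -/
noncomputable def pot {n : ℕ} (a : Fin n → ℤ) (p : ℝ≥0∞) (x : Fin n → ℤ) : ℝ≥0∞ :=
  ∏ i, if x i = a i then 1 else p

lemma pot_step_s7 {n : ℕ} (hn : 0 < n) (a x : Fin n → ℤ) (s : ℕ) :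
    ∑' z, mutP n pmStepP x z * (if fitness a z ≤ fitness a x then pot a (pSeq n s) z
      else pot a (pSeq n s) x) ≤ pot a (pSeq n (s + 1)) x := by
  have hp := pSeq_le_one hn s
  have hm := mut_sum n x
    (fun i z => if x i = a i then 1 else if z = x i then pSeq n s else 1)
    (fun i => if x i = a i then 1 else pSeq n s) (fun _ => 1)
    (by intro i; simp) (by intro i z hz; simp [hz])
  calc _ ≤ ∑' z, mutP n pmStepP x z *
        ∏ i, (if x i = a i then 1 else if z i = x i then pSeq n s else 1) := by
        refine ENNReal.tsum_le_tsum fun z => ?_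
        gcongr
        split_ifs with h
        · refine Finset.prod_le_prod' fun i _ => ?_
          split_ifs with h1 h2 h3 <;> first | exact le_rfl | exact hp | (exfalso; omega)
        · refine Finset.prod_le_prod' fun i _ => ?_
          split_ifs with h1 h2 h3 <;> first | exact le_rfl | exact hp | (exfalso; omega)
    _ = _ := by
        rw [hm, pot]
        refine Finset.prod_congr rfl fun i _ => ?_
        split_ifs
        · rw [mul_one, mul_one, inv_add_compl hn]
        · rw [mul_one, pSeq]

lemma pot_bound {n : ℕ} (hn : 0 < n) (a : Fin n → ℤ) (t s : ℕ) :
    ∑' x, eaDist n a pmStepP t x * pot a (pSeq n s) x ≤ pot a (pSeq n (s + t)) (fun _ => 0) := by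
  induction t generalizing s with
  | zero => rw [eaDist_start]; exact le_rfl
  | succ t ih =>
    rw [dist_step]
    calc _ ≤ ∑' x, eaDist n a pmStepP t x * pot a (pSeq n (s + 1)) x := by
          refine ENNReal.tsum_le_tsum fun x => ?_
          gcongr
          exact pot_step_s7 hn a x s
      _ ≤ _ := by
          have := ih (s + 1)
          rwa [show s + 1 + t = s + (t + 1) by ring] at this

lemma opt_le_pow {n : ℕ} (hn : 0 < n) (a : Fin n → ℤ) (t : ℕ) :
    optP n a t ≤ pSeq n t ^ normH a := by
  have h := pot_bound hn a t 0
  have e : pot a (pSeq n (0 + t)) (fun _ => 0) = pSeq n t ^ normH a := by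
    rw [pot, normH, zero_add, Finset.card_filter, ← Finset.prod_pow_eq_pow_sum]
    refine Finset.prod_congr rfl fun i _ => ?_
    by_cases hi : a i = 0
    · simp [hi]
    · simp [hi, Ne.symm hi]
  rw [e] at h
  refine le_trans (ENNReal.tsum_le_tsum fun x => ?_) h
  gcongr
  split_ifs with hx
  · rw [fitness_zero hx]; simp [pot]
  · exact zero_le

lemma pSeq_eq {n : ℕ} (hn : 0 < n) (t : ℕ) :
    pSeq n t = ENNReal.ofReal (1 - (1 - 1 / (n : ℝ)) ^ t) := by
  have hn' : (1 : ℝ) ≤ n := by exact_mod_cast hn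
  have h1 : 1 / (n : ℝ) ≤ 1 := by rw [div_le_one (by linarith)]; exact hn'
  have h0 : 0 ≤ 1 / (n : ℝ) := by positivity
  have e : (1 / (n : ℝ≥0∞)) = ENNReal.ofReal (1 / (n : ℝ)) := by
    rw [ENNReal.ofReal_div_of_pos (by linarith)]; simp
  have e2 : (1 - 1 / (n : ℝ≥0∞)) = ENNReal.ofReal (1 - 1 / (n : ℝ)) := by
    rw [ENNReal.ofReal_sub _ h0, ENNReal.ofReal_one, e]
  induction t with
  | zero => simp [pSeq]
  | succ t ih =>
    have h3 : (1 - 1 / (n : ℝ)) ^ t ≤ 1 := pow_le_one₀ (by linarith) (by linarith)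
    rw [pSeq, ih, e2, e, ← ENNReal.ofReal_mul (by linarith), ← ENNReal.ofReal_add _ h0]
    · congr 1; ring
    · exact mul_nonneg (by linarith) (by linarith)

lemma part_two {n : ℕ} (hn : 2 ≤ n) (a : Fin n → ℤ) (hh : 0 < normH a) :
    ENNReal.ofReal (n * Real.log (normH a) / 2 / 2) ≤ eaExpTime n a pmStepP := by
  have hn0 : 0 < n := by omega
  apply time_lower hn0
  intro t ht
  refine (opt_le_pow hn0 a t).trans ?_
  rw [pSeq_eq hn0]
  have hn' : (2 : ℝ) ≤ n := by exact_mod_cast hn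
  have hpos : (0 : ℝ) < n := by linarith
  have hH : (1 : ℝ) ≤ normH a := by exact_mod_cast hh
  set h : ℕ := normH a
  have hHp : (0 : ℝ) < h := by linarith
  have hq : Real.exp (-(2 / n)) ≤ 1 - 1 / (n : ℝ) := by
    rw [Real.exp_neg]
    have h1 : 0 < 1 - 1 / (n : ℝ) := by
      rw [sub_pos, div_lt_one hpos]; linarith
    rw [inv_le_comm₀ (Real.exp_pos _) h1]
    have h2 := Real.add_one_le_exp (2 / (n : ℝ))
    refine le_trans ?_ h2
    rw [inv_le_iff_one_le_mul₀ h1]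
    have : (2 / (n : ℝ) + 1) * (1 - 1 / n) = 1 + (n - 2) / n ^ 2 := by field_simp; ring
    rw [this]
    have : 0 ≤ ((n : ℝ) - 2) / n ^ 2 := div_nonneg (by linarith) (by positivity)
    linarith
  have hqt : 1 / (h : ℝ) ≤ (1 - 1 / (n : ℝ)) ^ t := by
    calc 1 / (h : ℝ) = Real.exp (-Real.log h) := by
          rw [Real.exp_neg, Real.exp_log hHp, one_div]
      _ ≤ Real.exp (t * -(2 / n)) := by
          apply Real.exp_le_exp.2
          have : (t : ℝ) * (2 / n) ≤ Real.log h := by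
            rw [mul_div_assoc', div_le_iff₀ hpos]; linarith
          linarith
      _ = Real.exp (-(2 / n)) ^ t := by rw [Real.exp_nat_mul]
      _ ≤ _ := pow_le_pow_left₀ (Real.exp_pos _).le hq t
  have hle1 : (1 - 1 / (n : ℝ)) ^ t ≤ 1 := by
    have : 0 ≤ 1 / (n : ℝ) := by positivity
    exact pow_le_one₀ ((Real.exp_pos _).le.trans hq) (by linarith)
  rw [← ENNReal.ofReal_pow (by linarith)]
  have hfin : (1 - (1 - 1 / (n : ℝ)) ^ t) ^ h ≤ 1 / 2 := by
    calc _ ≤ Real.exp (-(1 / h)) ^ h := by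
          apply pow_le_pow_left₀ (by linarith)
          have := Real.add_one_le_exp (-(1 / (h : ℝ)))
          linarith
      _ = Real.exp (-1) := by
          rw [← Real.exp_nat_mul]; congr 1; field_simp
      _ ≤ 1 / 2 := by
          rw [Real.exp_neg, one_div]
          apply inv_anti₀ (by norm_num)
          have := Real.add_one_le_exp (1 : ℝ)
          linarith
  calc _ ≤ ENNReal.ofReal (1 / 2) := ENNReal.ofReal_le_ofReal hfin
    _ = _ := by rw [ENNReal.ofReal_div_of_pos (by norm_num)]; simp

/-- **Lower bound for the (1+1) EA with the ±1 operator.**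
For every `a ∈ ℤⁿ \ {0ⁿ}`, the expected optimization time of the (1+1) EA with the `±1`
step operator, started at the all-`0` integer string, on `f_a` is
`Ω(|a|_∞ · n + n · log |a|_H)`. -/
theorem ea_pm_lower_bound :
    ∃ c : ℝ, 0 < c ∧ ∀ (n : ℕ) (a : Fin n → ℤ), a ≠ 0 →
      ENNReal.ofReal (c * ((normInf a : ℝ) * n + n * Real.log (normH a))) ≤
        eaExpTime n a pmStepP := by
  refine ⟨1 / 8, by norm_num, fun n a ha => ?_⟩
  obtain ⟨j, hj⟩ := Function.ne_iff.1 ha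
  have hn : 0 < n := j.pos
  have hh : 0 < normH a := Finset.card_pos.2 ⟨j, by simpa using hj⟩
  haveI : Nonempty (Fin n) := ⟨j⟩
  obtain ⟨i, -, hi⟩ := Finset.exists_mem_eq_sup Finset.univ Finset.univ_nonempty
    (fun i => (a i).natAbs)
  have h1 := part_one hn a i
  have hi' : normInf a = (a i).natAbs := hi
  rw [← hi'] at h1
  have h2 : ENNReal.ofReal (n * Real.log (normH a) / 2 / 2) ≤ eaExpTime n a pmStepP := by
    rcases Nat.lt_or_ge n 2 with h | h
    · have h3 : normH a ≤ n := by
        simpa [normH] using Finset.card_filter_le (Finset.univ : Finset (Fin n)) (fun i => a i ≠ 0)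
      have h4 : normH a = 1 := by omega
      simp [h4]
    · exact part_two h a hh
  rcases le_total ((normInf a : ℝ) * n) (n * Real.log (normH a)) with h | h
  · exact (ENNReal.ofReal_le_ofReal (by linarith)).trans h2
  · exact (ENNReal.ofReal_le_ofReal (by linarith)).trans h1
end

section
/- Coupon-collector-type inequality: For all integers n ≥ 2 and h ≥ 1, it holds that 1 − (1 − (1 − 1/n)^{(n−1)·ln h})^h ≥ 1 − e^{−1} ≥ 1/2. In particular, if each of h items is, in every round, independently marked with probability 1/n, then the probability that after (n−1)·ln h rounds at least one of the h items has never been marked is at least 1/2. -/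
/-- **Coupon-collector-type inequality.**
For all integers `n ≥ 2` and `h ≥ 1`,
`1 − (1 − (1 − 1/n)^{(n−1)·ln h})^h ≥ 1 − e⁻¹ ≥ 1/2`.
(In particular, if each of `h` items is, in every round, independently marked with
probability `1/n`, then the probability that after `(n−1)·ln h` rounds some item was never
marked is at least `1/2`.)  The inner power is the real power of `1 − 1/n` with real
exponent `(n−1)·ln h`; the outer power is the `h`-th power. -/
theorem coupon_collector_inequality (n h : ℕ) (hn : 2 ≤ n) (hh : 1 ≤ h) :
    1 - Real.exp (-1) ≤
      1 - (1 - (1 - 1 / (n : ℝ)) ^ (((n : ℝ) - 1) * Real.log h)) ^ h ∧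
    (1 : ℝ) / 2 ≤ 1 - Real.exp (-1) := by
  have hn' : (2 : ℝ) ≤ n := by exact_mod_cast hn
  have hh' : (1 : ℝ) ≤ h := by exact_mod_cast hh
  have hL : 0 ≤ Real.log h := Real.log_nonneg hh'
  have hn0 : (0 : ℝ) < n := by linarith
  have hn1 : (0 : ℝ) < (n : ℝ) - 1 := by linarith
  have hq : (1 - 1 / (n : ℝ)) = ((n : ℝ) - 1) / n := by field_simp
  have hb : 0 < 1 - 1 / (n : ℝ) := by rw [hq]; positivity
  have hb1 : 1 - 1 / (n : ℝ) ≤ 1 := by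
    have : 0 ≤ 1 / (n : ℝ) := by positivity
    linarith
  have hlog : -1 ≤ ((n : ℝ) - 1) * Real.log (1 - 1 / (n : ℝ)) := by
    have h1 := Real.one_sub_inv_le_log_of_pos hb
    have h2 := mul_le_mul_of_nonneg_left h1 hn1.le
    have h3 : ((n : ℝ) - 1) * (1 - (1 - 1 / (n : ℝ))⁻¹) = -1 := by
      rw [hq]
      field_simp
      ring
    linarith
  constructor
  · set p := (1 - 1 / (n : ℝ)) ^ (((n : ℝ) - 1) * Real.log h) with hp
    have hp1 : p ≤ 1 := Real.rpow_le_one hb.le hb1 (mul_nonneg hn1.le hL)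
    have hp2 : 1 ≤ h * p := by
      have h1 : Real.exp (-Real.log h) ≤ p := by
        rw [hp, Real.rpow_def_of_pos hb]
        apply Real.exp_le_exp.mpr
        nlinarith
      rw [Real.exp_neg, Real.exp_log (by linarith)] at h1
      have h2 := mul_le_mul_of_nonneg_left h1 (by linarith : (0 : ℝ) ≤ h)
      rwa [mul_inv_cancel₀ (by linarith)] at h2
    have h1 : (1 - p) ^ h ≤ Real.exp (-p) ^ h :=
      pow_le_pow_left₀ (by linarith) (Real.one_sub_le_exp_neg p) h
    rw [← Real.exp_nat_mul] at h1
    have h2 : Real.exp (h * -p) ≤ Real.exp (-1) := Real.exp_le_exp.mpr (by linarith)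
    linarith
  · have h1 : (2 : ℝ) ≤ Real.exp 1 := by
      have := Real.add_one_le_exp (1 : ℝ)
      linarith
    have h2 : Real.exp (-1) ≤ 1 / 2 := by
      rw [Real.exp_neg, one_div]
      exact inv_anti₀ (by norm_num) h1
    linarith
end

section
/- Upper bound for the (1+1) EA with the heavy-tailed operator: Fix ε > 0. For every a ∈ ℤⁿ \ {0ⁿ}, the expected optimization time of the (1+1) EA with the heavy-tailed step operator with parameter ε, started at the all-0 integer string, on the fitness function f_a is O(n · log²(|a|₁) · (log(log |a|₁))^{1+ε}). -/
open scoped ENNReal BigOperators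

lemma ea_tsum_pi_le (n : ℕ) (g : Fin n → ℤ → ℝ≥0∞) :
    ∑' y : Fin n → ℤ, ∏ i, g i (y i) ≤ ∏ i, ∑' z, g i z := by
  induction n with
  | zero => simp [tsum_fintype]
  | succ n ih =>
    rw [← (Fin.consEquiv (fun _ : Fin (n+1) => ℤ)).tsum_eq, Fin.prod_univ_succ,
      ENNReal.tsum_prod']
    simp only [Fin.consEquiv, Equiv.coe_fn_mk, Fin.prod_univ_succ, Fin.cons_zero, Fin.cons_succ]
    simp only [ENNReal.tsum_mul_left, ENNReal.tsum_mul_right]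
    gcongr
    exact ih _

lemma ea_mut_mass (n : ℕ) (hn : 0 < n) (st : ℤ → ℤ → ℝ≥0∞) (h1 : ∀ x, ∑' z, st x z ≤ 1)
    (x : Fin n → ℤ) : ∑' y, mutP n st x y ≤ 1 := by
  unfold mutP
  refine (ea_tsum_pi_le n (fun i z => coordMutP n st (x i) z)).trans ?_
  refine Finset.prod_le_one' fun i _ => ?_
  unfold coordMutP
  rw [ENNReal.tsum_add, ENNReal.tsum_mul_left, ENNReal.tsum_mul_left, tsum_ite_eq]
  have h2 : 1 / (n : ℝ≥0∞) ≤ 1 := by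
    rw [one_div]
    exact ENNReal.inv_le_one.2 (by exact_mod_cast hn)
  calc _ ≤ (1 - 1 / (n : ℝ≥0∞)) * 1 + 1 / (n : ℝ≥0∞) * 1 := by
        gcongr
        exact h1 _
    _ = 1 := by rw [mul_one, mul_one, tsub_add_cancel_of_le h2]

lemma ea_trans_mass (n : ℕ) (hn : 0 < n) (a : Fin n → ℤ) (st : ℤ → ℤ → ℝ≥0∞)
    (h1 : ∀ x, ∑' z, st x z ≤ 1)
    (x : Fin n → ℤ) : ∑' y, transP n a st x y ≤ 1 := by
  unfold transP
  rw [ENNReal.tsum_add, tsum_ite_eq, ← ENNReal.tsum_add]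
  refine le_trans (ENNReal.tsum_le_tsum fun y => ?_) (ea_mut_mass n hn st h1 x)
  by_cases h : fitness a y ≤ fitness a x
  · simp [h, not_lt.2 h]
  · simp [h, not_le.1 h]

lemma ea_time_le (n : ℕ) (a : Fin n → ℤ) (st : ℤ → ℤ → ℝ≥0∞) (V : (Fin n → ℤ) → ℝ≥0∞)
    (hV : ∀ x, (if fitness a x = 0 then 0 else 1) + ∑' y, transP n a st x y * V y ≤ V x) :
    eaExpTime n a st ≤ V (fun _ => 0) := by
  have key : ∀ T : ℕ, ∑ t ∈ Finset.range T,
      (∑' x : Fin n → ℤ, if fitness a x = 0 then 0 else eaDist n a st t x)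
      + ∑' x, eaDist n a st T x * V x ≤ V (fun _ => 0) := by
    intro T
    induction T with
    | zero => simp [eaDist]
    | succ T ih =>
      refine le_trans ?_ ih
      rw [Finset.sum_range_succ, add_assoc]
      gcongr
      simp only [eaDist, ← ENNReal.tsum_mul_right]
      rw [ENNReal.tsum_comm, ← ENNReal.tsum_add]
      refine ENNReal.tsum_le_tsum fun x => ?_
      calc _ = eaDist n a st T x *
            ((if fitness a x = 0 then 0 else 1) + ∑' y, transP n a st x y * V y) := by
            rw [mul_add, ← ENNReal.tsum_mul_left]
            congr 1
            · split_ifs <;> simp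
            · simp only [mul_assoc]
        _ ≤ _ := by gcongr; exact hV x
  unfold eaExpTime
  rw [ENNReal.tsum_eq_iSup_nat]
  exact iSup_le fun T => le_trans le_self_add (key T)

/-- potential -/
noncomputable def eaH (s : ℕ) : ℝ := if s = 0 then 0 else 1 + Real.log s

lemma eaH_drift (s s' : ℕ) (hs : 0 < s) (h : s' ≤ s) :
    eaH s' + ((s : ℝ) - s') / s ≤ eaH s := by
  have hs0 : (0 : ℝ) < s := by exact_mod_cast hs
  have h1 : (1:ℝ) ≤ s := by exact_mod_cast hs
  unfold eaH
  rw [if_neg hs.ne']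
  split_ifs with h0
  · subst h0
    have := Real.log_nonneg h1
    simp [hs0.ne']
    linarith
  · have hs'0 : (0 : ℝ) < s' := by exact_mod_cast Nat.pos_of_ne_zero h0
    have := Real.log_le_sub_one_of_pos (div_pos hs'0 hs0)
    rw [Real.log_div hs'0.ne' hs0.ne'] at this
    rw [sub_div, div_self hs0.ne']
    linarith

lemma eaH_nonneg (s : ℕ) : 0 ≤ eaH s := by
  unfold eaH
  split_ifs with h
  · exact le_rfl
  · have : (1:ℝ) ≤ s := by exact_mod_cast Nat.pos_of_ne_zero h
    have := Real.log_nonneg this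
    linarith

lemma ea_pow_lower (n : ℕ) (hn : 0 < n) :
    Real.exp (-1) ≤ (1 - 1 / (n:ℝ)) ^ (n - 1) := by
  obtain ⟨m, rfl⟩ : ∃ m, n = m + 1 := ⟨n - 1, by omega⟩
  rcases Nat.eq_zero_or_pos m with rfl | hm
  · simp
  have hm0 : (0:ℝ) < m := by exact_mod_cast hm
  have e1 : (1 - 1 / ((m + 1 : ℕ):ℝ)) = (1 + 1 / (m:ℝ))⁻¹ := by
    push_cast
    field_simp
    ring
  have e2 : (1 + 1 / (m:ℝ)) ^ m ≤ Real.exp 1 := by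
    calc (1 + 1 / (m:ℝ)) ^ m ≤ (Real.exp (1 / m)) ^ m := by
          gcongr
          linarith [Real.add_one_le_exp (1 / (m:ℝ))]
      _ = Real.exp 1 := by
          rw [← Real.exp_nat_mul]
          congr 1
          field_simp
  rw [e1, Real.exp_neg, inv_pow, Nat.add_sub_cancel]
  exact inv_anti₀ (by positivity) e2

lemma ea_mut_lower (n : ℕ) (hn : 0 < n) (st : ℤ → ℤ → ℝ≥0∞) (q : ℝ) (hq : 0 ≤ q)
    (x : Fin n → ℤ) (i : Fin n) (z : ℤ) (hz : ENNReal.ofReal q ≤ st (x i) z) :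
    ENNReal.ofReal (Real.exp (-1) / n * q) ≤ mutP n st x (Function.update x i z) := by
  have hn0 : (0:ℝ) < n := by exact_mod_cast hn
  have hinv : (1 / (n:ℝ≥0∞)) = ENNReal.ofReal (1 / n) := by
    rw [one_div, one_div, ENNReal.ofReal_inv_of_pos hn0, ENNReal.ofReal_natCast]
  unfold mutP
  rw [← Finset.mul_prod_erase _ _ (Finset.mem_univ i), Function.update_self]
  have h1 : (1 / (n:ℝ≥0∞)) * ENNReal.ofReal q ≤ coordMutP n st (x i) z := by
    unfold coordMutP
    exact le_add_left (by gcongr)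
  have h2 : ENNReal.ofReal (Real.exp (-1)) ≤
      ∏ j ∈ Finset.univ.erase i, coordMutP n st (x j) (Function.update x i z j) := by
    have h1n : 1 / (n:ℝ) ≤ 1 := by
      rw [div_le_one hn0]; exact_mod_cast hn
    calc ENNReal.ofReal (Real.exp (-1)) ≤ ENNReal.ofReal ((1 - 1 / (n:ℝ)) ^ (n - 1)) :=
          ENNReal.ofReal_le_ofReal (ea_pow_lower n hn)
      _ = (1 - 1 / (n : ℝ≥0∞)) ^ (n - 1) := by
          rw [ENNReal.ofReal_pow (by linarith), ENNReal.ofReal_sub _ (by positivity), hinv,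
            ENNReal.ofReal_one]
      _ = ∏ j ∈ Finset.univ.erase i, (1 - 1 / (n : ℝ≥0∞)) := by
          rw [Finset.prod_const, Finset.card_erase_of_mem (Finset.mem_univ _)]
          simp
      _ ≤ _ := by
          refine Finset.prod_le_prod' fun j hj => ?_
          rw [Function.update_of_ne (Finset.ne_of_mem_erase hj)]
          unfold coordMutP
          simp
  calc ENNReal.ofReal (Real.exp (-1) / n * q)
      = ENNReal.ofReal (1 / n) * ENNReal.ofReal q * ENNReal.ofReal (Real.exp (-1)) := by
        rw [← ENNReal.ofReal_mul (by positivity), ← ENNReal.ofReal_mul (by positivity)]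
        congr 1
        ring
    _ ≤ _ := by
        rw [← hinv]
        gcongr

lemma ea_fitness_update {n : ℕ} (a x : Fin n → ℤ) (i : Fin n) (z : ℤ) :
    fitness a (Function.update x i z) + (x i - a i).natAbs = fitness a x + (z - a i).natAbs := by
  unfold fitness
  rw [← Finset.add_sum_erase _ _ (Finset.mem_univ i),
    ← Finset.add_sum_erase _ (fun j => (x j - a j).natAbs) (Finset.mem_univ i),
    Function.update_self]
  have : ∑ j ∈ Finset.univ.erase i, (Function.update x i z j - a j).natAbs
      = ∑ j ∈ Finset.univ.erase i, (x j - a j).natAbs :=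
    Finset.sum_congr rfl fun j hj => by
      rw [Function.update_of_ne (Finset.ne_of_mem_erase hj)]
  rw [this]
  omega

lemma ea_drift_sum (n : ℕ) (hn : 0 < n) (a : Fin n → ℤ) (st : ℤ → ℤ → ℝ≥0∞) (q : ℝ)
    (hq : 0 < q) (x : Fin n → ℤ)
    (h2 : ∀ u b : ℤ, u ≠ b → (u - b).natAbs ≤ fitness a x → ∃ z, z ≠ u ∧
      2 * (z - b).natAbs ≤ (u - b).natAbs ∧ ENNReal.ofReal q ≤ st u z)
    (hx : 0 < fitness a x) :
    1 ≤ ∑' y, transP n a st x y * ENNReal.ofReal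
      (((fitness a x : ℝ) - fitness a y) / fitness a x / (Real.exp (-1) / n * q / 2)) := by
  have hn0 : (0:ℝ) < n := by exact_mod_cast hn
  set s := fitness a x with hs
  have hs0 : (0:ℝ) < s := by exact_mod_cast hx
  set r := Real.exp (-1) / n * q with hr
  have hr0 : 0 < r := by positivity
  have hdi : ∀ i, (x i - a i).natAbs ≤ s := fun i =>
    Finset.single_le_sum (f := fun i => (x i - a i).natAbs) (fun _ _ => Nat.zero_le _)
      (Finset.mem_univ i)
  have h3 : ∀ i : Fin n, ∃ z, x i ≠ a i → z ≠ x i ∧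
      2 * (z - a i).natAbs ≤ (x i - a i).natAbs ∧ ENNReal.ofReal q ≤ st (x i) z := by
    intro i
    by_cases h : x i = a i
    · exact ⟨0, fun h' => absurd h h'⟩
    · obtain ⟨z, hz⟩ := h2 (x i) (a i) h (hdi i)
      exact ⟨z, fun _ => hz⟩
  choose z hz using h3
  set S := Finset.univ.filter fun i => x i ≠ a i with hS
  set Y : Fin n → (Fin n → ℤ) := fun i => Function.update x i (z i) with hY
  have hinj : Set.InjOn Y S := by
    intro i hi j hj hij
    by_contra hne
    have := congrFun hij i
    simp only [hY, Function.update_self, Function.update_of_ne hne] at this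
    exact (hz i (by simpa [hS] using hi)).1 this
  set F : (Fin n → ℤ) → ℝ≥0∞ := fun y => transP n a st x y * ENNReal.ofReal
      (((s : ℝ) - fitness a y) / s / (r / 2)) with hF
  have hterm : ∀ i ∈ S, ENNReal.ofReal ((x i - a i).natAbs / (s : ℝ)) ≤ F (Y i) := by
    intro i hi
    obtain ⟨h1, h2, h3⟩ := hz i (by simpa [hS] using hi)
    have hf := ea_fitness_update a x i (z i)
    rw [← hs] at hf
    have hle : fitness a (Y i) ≤ fitness a x := by
      simp only [hY]; omega
    have hgain : ((x i - a i).natAbs : ℝ) ≤ 2 * ((s:ℝ) - fitness a (Y i)) := by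
      have : (x i - a i).natAbs + 2 * fitness a (Y i) ≤ 2 * s := by
        simp only [hY]; omega
      have : (((x i - a i).natAbs + 2 * fitness a (Y i) : ℕ) : ℝ) ≤ (2 * s : ℕ) := by
        exact_mod_cast this
      push_cast at this
      linarith
    have hP : ENNReal.ofReal r ≤ transP n a st x (Y i) := by
      refine (ea_mut_lower n hn st q hq.le x i (z i) h3).trans ?_
      unfold transP
      rw [if_pos hle]
      exact le_self_add
    calc ENNReal.ofReal ((x i - a i).natAbs / (s : ℝ))
        ≤ ENNReal.ofReal (r * (((s : ℝ) - fitness a (Y i)) / s / (r / 2))) := by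
          refine ENNReal.ofReal_le_ofReal ?_
          have : r * (((s : ℝ) - fitness a (Y i)) / s / (r / 2))
            = 2 * ((s:ℝ) - fitness a (Y i)) / s := by
            field_simp
          rw [this]
          gcongr
      _ = ENNReal.ofReal r * ENNReal.ofReal (((s : ℝ) - fitness a (Y i)) / s / (r / 2)) :=
          ENNReal.ofReal_mul hr0.le
      _ ≤ _ := by
          simp only [hF]
          gcongr
  calc (1:ℝ≥0∞) = ENNReal.ofReal (∑ i ∈ S, ((x i - a i).natAbs / (s : ℝ))) := by
        rw [← Finset.sum_div]
        have : ∑ i ∈ S, ((x i - a i).natAbs : ℝ) = s := by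
          rw [hs]
          unfold fitness
          push_cast
          refine Finset.sum_subset (Finset.filter_subset _ _) fun i _ hi => ?_
          have : x i = a i := by simpa [hS] using hi
          simp [this]
        rw [this, div_self hs0.ne', ENNReal.ofReal_one]
    _ = ∑ i ∈ S, ENNReal.ofReal ((x i - a i).natAbs / (s : ℝ)) :=
        ENNReal.ofReal_sum_of_nonneg fun i _ => by positivity
    _ ≤ ∑ i ∈ S, F (Y i) := Finset.sum_le_sum hterm
    _ = ∑ y ∈ S.image Y, F y := (Finset.sum_image hinj).symm
    _ ≤ ∑' y, F y := ENNReal.sum_le_tsum _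

lemma ea_general (n : ℕ) (hn : 0 < n) (a : Fin n → ℤ) (st : ℤ → ℤ → ℝ≥0∞) (q : ℝ)
    (hq : 0 < q) (h1 : ∀ x, ∑' z, st x z ≤ 1)
    (h2 : ∀ u b : ℤ, u ≠ b → (u - b).natAbs ≤ normOne a → ∃ z, z ≠ u ∧
      2 * (z - b).natAbs ≤ (u - b).natAbs ∧ ENNReal.ofReal q ≤ st u z) :
    eaExpTime n a st ≤ ENNReal.ofReal (eaH (normOne a) / (Real.exp (-1) / n * q / 2)) := by
  have hn0 : (0:ℝ) < n := by exact_mod_cast hn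
  set M := normOne a with hM
  set δ := Real.exp (-1) / n * q / 2 with hδ
  have hδ0 : 0 < δ := by positivity
  set V : (Fin n → ℤ) → ℝ≥0∞ := fun x =>
    if fitness a x ≤ M then ENNReal.ofReal (eaH (fitness a x) / δ) else ⊤ with hV
  have h0 : fitness a (fun _ => 0) = M := by
    simp [fitness, hM, normOne]
  have := ea_time_le n a st V ?_
  · simpa only [hV, h0, le_refl, if_true] using this
  intro x
  by_cases hxM : fitness a x ≤ M
  swap
  · simp [hV, hxM]
  have hsupp : ∀ y, fitness a x < fitness a y → transP n a st x y = 0 := by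
    intro y hy
    have : y ≠ x := by rintro rfl; exact lt_irrefl _ hy
    simp [transP, not_le.2 hy, this]
  rcases Nat.eq_zero_or_pos (fitness a x) with hx | hx
  · rw [if_pos hx, zero_add]
    refine le_of_eq_of_le ?_ zero_le
    refine ENNReal.tsum_eq_zero.2 fun y => ?_
    by_cases hy : fitness a y = 0
    · simp [hV, hy, eaH]
    · rw [hsupp y (by omega), zero_mul]
  · rw [if_neg hx.ne']
    have hsum := ea_drift_sum n hn a st q hq x (fun u b hub hd => h2 u b hub (hd.trans hxM)) hx
    calc _ ≤ ∑' y, transP n a st x y * ENNReal.ofReal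
            (((fitness a x : ℝ) - fitness a y) / fitness a x / δ)
            + ∑' y, transP n a st x y * V y := by gcongr
      _ ≤ ∑' y, transP n a st x y * V x := by
          rw [← ENNReal.tsum_add]
          refine ENNReal.tsum_le_tsum fun y => ?_
          by_cases hy : fitness a x < fitness a y
          · simp [hsupp y hy]
          push Not at hy
          rw [← mul_add]
          gcongr
          simp only [hV, hxM, hy.trans hxM, if_true]
          rw [← ENNReal.ofReal_add]
          · refine ENNReal.ofReal_le_ofReal ?_
            rw [← add_div]
            have := eaH_drift _ _ hx hy
            gcongr
            linarith
          · have : (fitness a y : ℝ) ≤ fitness a x := by exact_mod_cast hy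
            have : 0 ≤ (fitness a x : ℝ) - fitness a y := by linarith
            positivity
          · exact div_nonneg (eaH_nonneg _) hδ0.le
      _ ≤ 1 * V x := by
          rw [ENNReal.tsum_mul_right]
          gcongr
          exact ea_trans_mass n hn a st h1 x
      _ = V x := one_mul _

/-- weights -/
noncomputable def eaW (ε : ℝ) (i : ℕ) : ℝ := i * Real.log i ^ (1 + ε)

lemma eaW_pos (ε : ℝ) (i : ℕ) (hi : 2 ≤ i) : 0 < eaW ε i := by
  have : (1:ℝ) < i := by exact_mod_cast hi
  have := Real.log_pos this
  unfold eaW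
  positivity

lemma eaW_mono (ε : ℝ) (hε : 0 < ε) (i j : ℕ) (hi : 1 ≤ i) (hij : i ≤ j) :
    eaW ε i ≤ eaW ε j := by
  have h1 : (1:ℝ) ≤ i := by exact_mod_cast hi
  have := Real.log_nonneg h1
  unfold eaW
  gcongr

lemma ea_summable (ε : ℝ) (hε : 0 < ε) :
    Summable (fun i : ℕ => if 2 ≤ i then 1 / ((i:ℝ) * Real.log i ^ (1 + ε)) else 0) := by
  have hg : Summable (fun i : ℕ => 1 / eaW ε (max i 2)) := by
    rw [← summable_condensed_iff_of_nonneg]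
    · rw [← summable_nat_add_iff 1]
      have hs : Summable (fun k : ℕ => (1 / Real.log 2 ^ (1 + ε)) * (1 / ((k + 1 : ℕ):ℝ) ^ (1 + ε))) :=
        ((summable_nat_add_iff 1).2
          (Real.summable_one_div_nat_rpow.2 (by linarith : 1 < 1 + ε))).mul_left _
      refine hs.congr fun k => ?_
      have h2 : 2 ≤ 2 ^ (k + 1) := by
        rw [pow_succ]; have := Nat.one_le_two_pow (n := k); omega
      have hl : 0 < Real.log 2 := Real.log_pos (by norm_num)
      rw [max_eq_left h2, eaW]
      push_cast
      rw [Real.log_pow, Real.mul_rpow (by positivity) hl.le]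
      push_cast
      field_simp
    · intro i
      exact one_div_nonneg.2 (eaW_pos ε _ (le_max_right _ _)).le
    · intro m n hm hmn
      refine one_div_le_one_div_of_le (eaW_pos ε _ (le_max_right _ _)) ?_
      exact eaW_mono ε hε _ _ (by omega) (by omega)
  refine Summable.of_nonneg_of_le ?_ ?_ hg
  · intro i
    split_ifs with h
    · exact one_div_nonneg.2 (eaW_pos ε i h).le
    · exact le_rfl
  · intro i
    split_ifs with h
    · rw [max_eq_left h]; exact le_rfl
    · exact one_div_nonneg.2 (eaW_pos ε _ (le_max_right _ _)).le

lemma ea_c_pos (ε : ℝ) (hε : 0 < ε) : 0 < cEps ε := by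
  unfold cEps
  refine (ea_summable ε hε).tsum_pos (fun i => ?_) 2 ?_
  · split_ifs with h
    · exact one_div_nonneg.2 (eaW_pos ε i h).le
    · exact le_rfl
  · rw [if_pos le_rfl]
    exact one_div_pos.2 (eaW_pos ε 2 le_rfl)

lemma ea_step_mass (ε : ℝ) (hε : 0 < ε) (x : ℤ) : ∑' z, htStepP ε x z ≤ 1 := by
  have hc := ea_c_pos ε hε
  unfold htStepP
  rw [ENNReal.tsum_comm]
  calc _ ≤ ∑' i : ℕ, ENNReal.ofReal
        ((1 / cEps ε) * (if 2 ≤ i then 1 / ((i:ℝ) * Real.log i ^ (1 + ε)) else 0)) := by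
        refine ENNReal.tsum_le_tsum fun i => ?_
        by_cases h : 2 ≤ i
        · simp only [h, true_and, if_true]
          set w := ENNReal.ofReal (1 / (2 * (cEps ε * i * Real.log i ^ (1 + ε)))) with hw
          calc _ ≤ ∑' z : ℤ, ((if z = x + 2 ^ (i - 2) then w else 0)
                + (if z = x - 2 ^ (i - 2) then w else 0)) := by
                refine ENNReal.tsum_le_tsum fun z => ?_
                by_cases h1 : z = x + 2 ^ (i - 2)
                · simp only [h1, true_or, if_true]; exact le_self_add
                · by_cases h2 : z = x - 2 ^ (i - 2)
                  · simp only [h2, or_true, if_true]; exact le_add_self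
                  · simp [h1, h2]
            _ = w + w := by rw [ENNReal.tsum_add, tsum_ite_eq, tsum_ite_eq]
            _ ≤ _ := by
                have hp := eaW_pos ε i h
                have : 0 ≤ 1 / (2 * (cEps ε * i * Real.log i ^ (1 + ε))) := by
                  rw [mul_assoc (cEps ε)]
                  change 0 ≤ 1 / (2 * (cEps ε * eaW ε i))
                  positivity
                rw [hw, ← ENNReal.ofReal_add this this]
                refine ENNReal.ofReal_le_ofReal (le_of_eq ?_)
                rw [mul_assoc (cEps ε)]
                change 1 / (2 * (cEps ε * eaW ε i)) + 1 / (2 * (cEps ε * eaW ε i))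
                  = 1 / cEps ε * (1 / eaW ε i)
                field_simp
                norm_num
        · simp [h]
    _ = ENNReal.ofReal (∑' i : ℕ,
        ((1 / cEps ε) * (if 2 ≤ i then 1 / ((i:ℝ) * Real.log i ^ (1 + ε)) else 0))) := by
        refine (ENNReal.ofReal_tsum_of_nonneg (fun i => ?_) ((ea_summable ε hε).mul_left _)).symm
        refine mul_nonneg (by positivity) ?_
        split_ifs with h
        · exact one_div_nonneg.2 (eaW_pos ε i h).le
        · exact le_rfl
    _ = 1 := by
        rw [tsum_mul_left]
        change ENNReal.ofReal (1 / cEps ε * cEps ε) = 1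
        rw [one_div, inv_mul_cancel₀ hc.ne', ENNReal.ofReal_one]

lemma ea_step_good (ε : ℝ) (hε : 0 < ε) (M : ℕ) (u b : ℤ) (hub : u ≠ b)
    (hd : (u - b).natAbs ≤ M) : ∃ z, z ≠ u ∧ 2 * (z - b).natAbs ≤ (u - b).natAbs ∧
      ENNReal.ofReal (1 / (2 * (cEps ε * eaW ε (Nat.log 2 M + 2)))) ≤ htStepP ε u z := by
  have hc := ea_c_pos ε hε
  set d := (u - b).natAbs with hdd
  have hd0 : d ≠ 0 := by omega
  set k := Nat.log 2 d with hk
  have hk1 : 2 ^ k ≤ d := Nat.pow_log_le_self 2 hd0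
  have hk2 : d < 2 ^ k * 2 := by
    have := Nat.lt_pow_succ_log_self (b := 2) (by norm_num) d
    rwa [pow_succ] at this
  have hk3 : 0 < 2 ^ k := by positivity
  have hkM : k ≤ Nat.log 2 M := Nat.log_mono_right hd
  have hstep : ∀ z : ℤ, (z = u + 2 ^ k ∨ z = u - 2 ^ k) →
      ENNReal.ofReal (1 / (2 * (cEps ε * eaW ε (Nat.log 2 M + 2)))) ≤ htStepP ε u z := by
    intro z hz
    unfold htStepP
    refine le_trans ?_ (ENNReal.le_tsum (k + 2))
    rw [if_pos ⟨by omega, by simpa using hz⟩]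
    refine ENNReal.ofReal_le_ofReal ?_
    rw [mul_assoc (cEps ε)]
    change _ ≤ 1 / (2 * (cEps ε * eaW ε (k + 2)))
    have := eaW_pos ε (k + 2) (by omega)
    have := eaW_mono ε hε (k + 2) (Nat.log 2 M + 2) (by omega) (by omega)
    gcongr
  have hcast : ((2 ^ k : ℕ) : ℤ) = 2 ^ k := by push_cast; rfl
  generalize 2 ^ k = p at hk1 hk2 hk3 hcast
  rw [← hcast] at hstep
  by_cases h : u < b
  · exact ⟨u + p, by omega, by omega, hstep _ (Or.inl rfl)⟩
  · exact ⟨u - p, by omega, by omega, hstep _ (Or.inr rfl)⟩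

lemma ea_asymp (ε : ℝ) (hε : 0 < ε) (M : ℕ) (hM : 81 ≤ M) :
    eaH M * eaW ε (Nat.log 2 M + 2) ≤
      8 * 2 ^ (1 + ε) * (Real.log M ^ 2 * Real.log (Real.log M) ^ (1 + ε)) := by
  have hM0 : (81:ℝ) ≤ M := by exact_mod_cast hM
  set L := Real.log M with hL
  have hL4 : 4 ≤ L := by
    have h3 : (1:ℝ) ≤ Real.log 3 := by
      rw [Real.le_log_iff_exp_le (by norm_num)]
      exact Real.exp_one_lt_three.le
    have : Real.log 81 ≤ L := Real.log_le_log (by norm_num) hM0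
    have h81 : Real.log 81 = 4 * Real.log 3 := by
      rw [show (81:ℝ) = 3 ^ 4 by norm_num, Real.log_pow]; norm_num
    linarith
  have h1 : eaH M ≤ 2 * L := by
    unfold eaH
    rw [if_neg (by omega)]
    linarith
  have hK : (Nat.log 2 M : ℝ) ≤ 2 * L := by
    have : (2:ℝ) ^ (Nat.log 2 M) ≤ M := by
      exact_mod_cast Nat.pow_log_le_self 2 (by omega)
    have := Real.log_le_log (by positivity) this
    rw [Real.log_pow] at this
    have hl2 := Real.log_two_gt_d9
    have hk0 : (0:ℝ) ≤ Nat.log 2 M := by positivity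
    nlinarith
  have hK2 : ((Nat.log 2 M + 2 : ℕ) : ℝ) ≤ 4 * L := by push_cast; linarith
  have hlog : Real.log ((Nat.log 2 M + 2 : ℕ) : ℝ) ≤ 2 * Real.log L := by
    calc _ ≤ Real.log (4 * L) := Real.log_le_log (by positivity) hK2
      _ = Real.log 4 + Real.log L := Real.log_mul (by norm_num) (by linarith)
      _ ≤ _ := by
        have := Real.log_le_log (by norm_num) hL4
        linarith
  have hlog0 : 0 ≤ Real.log ((Nat.log 2 M + 2 : ℕ) : ℝ) := Real.log_natCast_nonneg _
  have hLL : 0 ≤ Real.log L := Real.log_nonneg (by linarith)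
  calc eaH M * eaW ε (Nat.log 2 M + 2)
      ≤ (2 * L) * ((4 * L) * (2 * Real.log L) ^ (1 + ε)) := by
        unfold eaW
        gcongr
    _ = _ := by
        rw [Real.mul_rpow (by norm_num) hLL]
        ring

/-- **Upper bound for the (1+1) EA with the heavy-tailed operator.**
Fix `ε > 0`.  For every `a ∈ ℤⁿ \ {0ⁿ}` (with `|a|₁` large enough, as expressed by the
threshold `N` of the `O`-notation), the expected optimization time of the (1+1) EA with the
heavy-tailed step operator with parameter `ε`, started at the all-`0` integer string, on
`f_a` is `O(n · log²(|a|₁) · (log log |a|₁)^{1+ε})`. -/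
theorem ea_ht_upper_bound (ε : ℝ) (hε : 0 < ε) :
    ∃ C : ℝ, 0 < C ∧ ∃ N : ℕ, ∀ (n : ℕ) (a : Fin n → ℤ), a ≠ 0 → N ≤ normOne a →
      eaExpTime n a (htStepP ε) ≤
        ENNReal.ofReal (C * n * Real.log (normOne a) ^ 2 *
          Real.log (Real.log (normOne a)) ^ (1 + ε)) := by
  have hc := ea_c_pos ε hε
  refine ⟨4 * cEps ε * Real.exp 1 * (8 * 2 ^ (1 + ε)), by positivity, 81, ?_⟩
  intro n a ha hN
  have hn : 0 < n := by
    rcases Nat.eq_zero_or_pos n with rfl | h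
    · exact absurd (Subsingleton.elim a 0) ha
    · exact h
  have hn0 : (0:ℝ) < n := by exact_mod_cast hn
  have hw := eaW_pos ε (Nat.log 2 (normOne a) + 2) (by omega)
  refine (ea_general n hn a (htStepP ε)
    (1 / (2 * (cEps ε * eaW ε (Nat.log 2 (normOne a) + 2)))) (by positivity)
    (ea_step_mass ε hε)
    (fun u b hub hd => ea_step_good ε hε (normOne a) u b hub hd)).trans ?_
  refine ENNReal.ofReal_le_ofReal ?_
  have key := ea_asymp ε hε (normOne a) hN
  calc _ = 4 * cEps ε * Real.exp 1 * n *
        (eaH (normOne a) * eaW ε (Nat.log 2 (normOne a) + 2)) := by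
        rw [Real.exp_neg]
        field_simp
        norm_num
    _ ≤ 4 * cEps ε * Real.exp 1 * n * _ := mul_le_mul_of_nonneg_left key (by positivity)
    _ = _ := by ring
end
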